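/- arXiv:1503.02627 — 10 statements merged into one kernel-verified Lean document; each statement's English description precedes it below -/
import Mathlib

section
/- Let A be a finite type equipped with binary operations ⋆ and ⊓ and unary operations d and r. If there exist a type X and a representation of (A, ⋆, ⊓, d, r) by partial functions on X, then there exist a finite type Y and a representation of (A, ⋆, ⊓, d, r) by partial functions on Y. (The finite representation property for the signature {composition, intersection, domain, range}.) -/
universe u v w

/-- A set of pairs is functional (is a partial function). -/
def Functional {X : Type u} (f : Set (X × X)) : Prop :=
  ∀ x y y' : X, (x, y) ∈ f → (x, y') ∈ f → y = y'

/-- Composition of partial functions (left-to-right). -/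
def pComp {X : Type u} (f g : Set (X × X)) : Set (X × X) :=
  {p | ∃ y, (p.1, y) ∈ f ∧ (y, p.2) ∈ g}

/-- Diagonal of the domain. -/
def pDom {X : Type u} (f : Set (X × X)) : Set (X × X) :=
  {p | p.1 = p.2 ∧ ∃ y, (p.1, y) ∈ f}

/-- Diagonal of the range. -/
def pRan {X : Type u} (f : Set (X × X)) : Set (X × X) :=
  {p | p.1 = p.2 ∧ ∃ x, (x, p.2) ∈ f}

/-- The identity function on `X`. -/
def pId (X : Type u) : Set (X × X) := {p | p.1 = p.2}

/-- Diagonal of the antidomain. -/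
def pAnti {X : Type u} (f : Set (X × X)) : Set (X × X) :=
  {p | p.1 = p.2 ∧ ¬∃ y, (p.1, y) ∈ f}

/-- Fixset: diagonal of the fixed points. -/
def pFix {X : Type u} (f : Set (X × X)) : Set (X × X) :=
  {p | p.1 = p.2 ∧ (p.1, p.1) ∈ f}

/-- Preferential union. -/
def pPref {X : Type u} (f g : Set (X × X)) : Set (X × X) :=
  f ∪ {p | p ∈ g ∧ ¬∃ z, (p.1, z) ∈ f}

/-- Iterated composition: `pPow f 0 = pId X`, `pPow f (n+1) = f ∘ pPow f n`. -/
def pPow {X : Type u} (f : Set (X × X)) : ℕ → Set (X × X)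
  | 0 => pId X
  | n + 1 => pComp f (pPow f n)

/-- Maximum iterate. -/
def pMaxIter {X : Type u} (f : Set (X × X)) : Set (X × X) :=
  ⋃ n : ℕ, pComp (pPow f n) (pAnti f)

/-- Opposite (bilateral inverse). -/
def pOpp {X : Type u} (f : Set (X × X)) : Set (X × X) :=
  {p | (p.2, p.1) ∈ f ∧ ∀ x', (x', p.1) ∈ f → x' = p.2}

/-- Unique-preimage operation. -/
def pU {X : Type u} (f : Set (X × X)) : Set (X × X) :=
  {p | p.1 = p.2 ∧ ∃! x, (x, p.2) ∈ f}

/-- The future of a vertex `x` with respect to `θ`. -/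
def future {A : Type*} {X : Type u} (θ : A → Set (X × X)) (x : X) : Set X :=
  {y | ∃ b : A, (x, y) ∈ θ b}

/-- The present of a vertex `x` with respect to `θ`. -/
def present {A : Type*} {X : Type u} (θ : A → Set (X × X)) (x : X) : Set X :=
  {y | y ∈ future θ x ∧ x ∈ future θ y}

/-- `a` labels the edge `(x, y)`: `a` holds there and is least among elements holding there. -/
def Labels {A : Type*} {X : Type u} (meet : A → A → A) (θ : A → Set (X × X))
    (a : A) (x y : X) : Prop :=
  (x, y) ∈ θ a ∧ ∀ b : A, (x, y) ∈ θ b → meet a b = a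

/-- Representation for the signature {composition, intersection, domain, range}. -/
def IsRepDR {A : Type*} {X : Type u} (star meet : A → A → A) (d r : A → A)
    (θ : A → Set (X × X)) : Prop :=
  Function.Injective θ ∧ (∀ a, Functional (θ a)) ∧
  (∀ a b, θ (star a b) = pComp (θ a) (θ b)) ∧
  (∀ a b, θ (meet a b) = θ a ∩ θ b) ∧
  (∀ a, θ (d a) = pDom (θ a)) ∧
  (∀ a, θ (r a) = pRan (θ a))

/-- A colouring `c` separates the points reachable from `x` (including `x` itself). -/
def Separates {A : Type*} {X : Type u} {C : Type*} (θ : A → Set (X × X)) (x : X) (c : X → C) :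
    Prop :=
  Set.InjOn c (insert x (future θ x))

/-- The colour of `x` together with the colour of its image (if any) under each element. -/
def colourCode {A : Type*} {X : Type u} {C : Type*} (θ : A → Set (X × X)) (x : X) (c : X → C) :
    C × (A → Set C) :=
  (c x, fun a => c '' {y | (x, y) ∈ θ a})

/-- The relations induced by `θ` on codes, transported along a map `e` out of the type of codes. -/
def codeRep {A : Type*} {X : Type u} {C Y : Type*} (θ : A → Set (X × X))
    (e : C × (A → Set C) → Y) (a : A) : Set (Y × Y) :=
  {p | ∃ x y c, Separates θ x c ∧ (x, y) ∈ θ a ∧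
    e (colourCode θ x c) = p.1 ∧ e (colourCode θ y c) = p.2}

theorem colourCode_congr {A : Type*} {X : Type u} {C : Type*} {θ : A → Set (X × X)} {x : X}
    {c c' : X → C} (h : Set.EqOn c c' (insert x (future θ x))) :
    colourCode θ x c = colourCode θ x c' := by
  refine Prod.ext (h (Set.mem_insert _ _)) (funext fun a => Set.image_congr fun y hy => ?_)
  exact h (Set.mem_insert_of_mem _ ⟨a, hy⟩)

theorem Separates.eq_of_colourCode_eq {A : Type*} {X : Type u} {C : Type*} {θ : A → Set (X × X)}
    {x y z : X} {c : X → C} {a b : A} (hc : Separates θ x c) (hy : (x, y) ∈ θ a)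
    (hz : (x, z) ∈ θ b) (h : colourCode θ y c = colourCode θ z c) : y = z :=
  hc (Or.inr ⟨a, hy⟩) (Or.inr ⟨b, hz⟩) (congrArg Prod.fst h)

/-- An injective colouring of a set extends to any superset injecting into the set of colours. -/
theorem Set.InjOn.exists_extend_of_injective {X C : Type*} [Finite C] {s t : Set X} {c : X → C}
    (hc : Set.InjOn c s) (hst : s ⊆ t) {g : t → C} (hg : Function.Injective g) :
    ∃ c' : X → C, Set.InjOn c' t ∧ Set.EqOn c' c s := by
  classical
  cases nonempty_fintype C
  have : Finite t := Finite.of_injective g hg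
  cases nonempty_fintype t
  let f : t → C := fun z => c z
  let s' : Finset t := {z | (z : X) ∈ s}
  have hf : Set.InjOn f s' := fun z hz w hw hzw =>
    Subtype.ext (hc (by simpa [s'] using hz) (by simpa [s'] using hw) hzw)
  obtain ⟨T, hT, -, hcard⟩ := Finset.exists_subsuperset_card_eq (Finset.subset_univ (s'.image f))
    (n := Fintype.card t) (Finset.card_image_le.trans (Finset.card_le_univ _))
    (Fintype.card_le_of_injective g hg)
  obtain ⟨k, hk⟩ := Finset.exists_equiv_extend_of_card_eq hcard.symm hT hf
  refine ⟨fun z => if hz : z ∈ t then k ⟨z, hz⟩ else c z, fun z hz w hw hzw => ?_, fun z hz => ?_⟩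
  · simpa [hz, hw, Subtype.coe_inj] using hzw
  · simpa [hst hz] using hk ⟨z, hst hz⟩ (by simpa [s'] using hz)

namespace IsRepDR

variable {A : Type*} {X : Type u} {star meet : A → A → A} {d r : A → A} {θ : A → Set (X × X)}

theorem mem_star (h : IsRepDR star meet d r θ) {a b : A} {x z : X} :
    (x, z) ∈ θ (star a b) ↔ ∃ y, (x, y) ∈ θ a ∧ (y, z) ∈ θ b := by
  rw [h.2.2.1]; rfl

theorem mem_meet (h : IsRepDR star meet d r θ) {a b : A} {x y : X} :
    (x, y) ∈ θ (meet a b) ↔ (x, y) ∈ θ a ∧ (x, y) ∈ θ b := by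
  rw [h.2.2.2.1]; rfl

theorem mem_dom (h : IsRepDR star meet d r θ) {a : A} {x y : X} :
    (x, y) ∈ θ (d a) ↔ x = y ∧ ∃ z, (x, z) ∈ θ a := by
  rw [h.2.2.2.2.1]; rfl

theorem mem_ran (h : IsRepDR star meet d r θ) {a : A} {x y : X} :
    (x, y) ∈ θ (r a) ↔ x = y ∧ ∃ z, (z, y) ∈ θ a := by
  rw [h.2.2.2.2.2]; rfl

theorem insert_future_subset (h : IsRepDR star meet d r θ) {a : A} {x y : X}
    (hxy : (x, y) ∈ θ a) : insert y (future θ y) ⊆ insert x (future θ x) := by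
  rintro z (rfl | ⟨b, hb⟩)
  · exact Or.inr ⟨a, hxy⟩
  · exact Or.inr ⟨star a b, h.mem_star.2 ⟨y, hxy, hb⟩⟩

theorem separates_of_mem (h : IsRepDR star meet d r θ) {C : Type*} {c : X → C} {a : A} {x y : X}
    (hxy : (x, y) ∈ θ a) (hc : Separates θ x c) : Separates θ y c :=
  Set.InjOn.mono (h.insert_future_subset hxy) hc

theorem image_star (h : IsRepDR star meet d r θ) {a : A} {x y : X} (hxy : (x, y) ∈ θ a) (b : A) :
    {z | (x, z) ∈ θ (star a b)} = {z | (y, z) ∈ θ b} := by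
  ext z
  refine h.mem_star.trans ⟨?_, fun hz => ⟨y, hxy, hz⟩⟩
  rintro ⟨y', hy', hz⟩
  exact h.2.1 a x y' y hy' hxy ▸ hz

theorem exists_mem_of_colourCode_eq (h : IsRepDR star meet d r θ) {C : Type*} {c c' : X → C}
    {a : A} {x x' y : X} (hcode : colourCode θ x c = colourCode θ x' c') (hxy : (x, y) ∈ θ a) :
    ∃ y', (x', y') ∈ θ a ∧ colourCode θ y c = colourCode θ y' c' := by
  have himg : ∀ b, c '' {z | (x, z) ∈ θ b} = c' '' {z | (x', z) ∈ θ b} :=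
    congrFun (congrArg Prod.snd hcode)
  obtain ⟨y', hy', hcy⟩ : c y ∈ c' '' {z | (x', z) ∈ θ a} := himg a ▸ ⟨y, hxy, rfl⟩
  refine ⟨y', hy', Prod.ext hcy.symm (funext fun b => ?_)⟩
  have := himg (star a b)
  rwa [h.image_star hxy, h.image_star hy'] at this

theorem mem_codeRep (h : IsRepDR star meet d r θ) {C Y : Type*} {e : C × (A → Set C) → Y}
    (he : Function.Injective e) {c : X → C} {a : A} {x : X} (hc : Separates θ x c) {v : Y} :
    (e (colourCode θ x c), v) ∈ codeRep θ e a ↔ ∃ y, (x, y) ∈ θ a ∧ e (colourCode θ y c) = v := by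
  constructor
  · rintro ⟨x', y', c', -, hxy', hu, rfl⟩
    obtain ⟨y, hxy, hy⟩ := h.exists_mem_of_colourCode_eq (he hu) hxy'
    exact ⟨y, hxy, congrArg e hy.symm⟩
  · rintro ⟨y, hxy, rfl⟩
    exact ⟨x, y, c, hc, hxy, rfl, rfl⟩

theorem exists_injective_reachable (h : IsRepDR star meet d r θ) (x : X) :
    ∃ g : ↥(insert x (future θ x)) → Option A, Function.Injective g := by
  have hg : ∀ y : ↥(insert x (future θ x)), ∃ o : Option A,
      o.elim ((y : X) = x) fun a => (x, (y : X)) ∈ θ a := by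
    rintro ⟨y, hy | ⟨a, ha⟩⟩
    · exact ⟨none, hy⟩
    · exact ⟨some a, ha⟩
  choose g hg using hg
  refine ⟨g, fun y z hyz => Subtype.ext ?_⟩
  have hy := hg y
  have hz := hg z
  rw [← hyz] at hz
  cases ho : g y with
  | none =>
    rw [ho] at hy hz
    exact Eq.trans hy (Eq.symm hz)
  | some a =>
    rw [ho] at hy hz
    exact h.2.1 a x y z hy hz

theorem exists_separates [Finite A] (h : IsRepDR star meet d r θ) (x : X) :
    ∃ c : X → Option A, Separates θ x c := by
  obtain ⟨g, hg⟩ := h.exists_injective_reachable x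
  obtain ⟨c, hc, -⟩ := (Set.injOn_empty fun _ => none).exists_extend_of_injective
    (Set.empty_subset _) hg
  exact ⟨c, hc⟩

theorem exists_separates_extend [Finite A] (h : IsRepDR star meet d r θ) {c : X → Option A}
    {a : A} {x y : X} (hxy : (x, y) ∈ θ a) (hc : Separates θ y c) :
    ∃ c' : X → Option A, Separates θ x c' ∧ colourCode θ y c' = colourCode θ y c := by
  obtain ⟨g, hg⟩ := h.exists_injective_reachable x
  obtain ⟨c', hc', heq⟩ := hc.exists_extend_of_injective (h.insert_future_subset hxy) hg
  exact ⟨c', hc', colourCode_congr heq⟩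

theorem codeRep_isRepDR [Finite A] (h : IsRepDR star meet d r θ) {Y : Type*}
    {e : Option A × (A → Set (Option A)) → Y} (he : Function.Injective e) :
    IsRepDR star meet d r (codeRep θ e) := by
  refine ⟨?_, ?_, ?_, ?_, ?_, ?_⟩
  · have key : ∀ a b, codeRep θ e a = codeRep θ e b → θ a ⊆ θ b := by
      rintro a b hab ⟨x, y⟩ hxy
      obtain ⟨c, hc⟩ := h.exists_separates x
      obtain ⟨y', hxy', hy⟩ := (h.mem_codeRep he hc).1 (hab ▸ (h.mem_codeRep he hc).2 ⟨y, hxy, rfl⟩)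
      rwa [← hc.eq_of_colourCode_eq hxy' hxy (he hy)]
    exact fun a b hab => h.1 ((key a b hab).antisymm (key b a hab.symm))
  · rintro a _ v v' ⟨x, y, c, hc, hxy, rfl, rfl⟩ hv'
    obtain ⟨y', hxy', rfl⟩ := (h.mem_codeRep he hc).1 hv'
    rw [h.2.1 a x y y' hxy hxy']
  · rintro a b
    ext ⟨u, v⟩
    constructor
    · rintro ⟨x, z, c, hc, hxz, rfl, rfl⟩
      obtain ⟨y, hxy, hyz⟩ := h.mem_star.1 hxz
      exact ⟨_, ⟨x, y, c, hc, hxy, rfl, rfl⟩, y, z, c, h.separates_of_mem hxy hc, hyz, rfl, rfl⟩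
    · rintro ⟨_, ⟨x, y, c, hc, hxy, rfl, rfl⟩, hv⟩
      obtain ⟨z, hyz, rfl⟩ := (h.mem_codeRep he (h.separates_of_mem hxy hc)).1 hv
      exact ⟨x, z, c, hc, h.mem_star.2 ⟨y, hxy, hyz⟩, rfl, rfl⟩
  · rintro a b
    ext ⟨u, v⟩
    constructor
    · rintro ⟨x, y, c, hc, hxy, rfl, rfl⟩
      obtain ⟨ha, hb⟩ := h.mem_meet.1 hxy
      exact ⟨⟨x, y, c, hc, ha, rfl, rfl⟩, x, y, c, hc, hb, rfl, rfl⟩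
    · rintro ⟨⟨x, y, c, hc, hxy, rfl, rfl⟩, hv⟩
      obtain ⟨y', hxy', hy⟩ := (h.mem_codeRep he hc).1 hv
      obtain rfl := hc.eq_of_colourCode_eq hxy' hxy (he hy)
      exact ⟨x, y', c, hc, h.mem_meet.2 ⟨hxy, hxy'⟩, rfl, rfl⟩
  · rintro a
    ext ⟨u, v⟩
    constructor
    · rintro ⟨x, y, c, hc, hxy, rfl, rfl⟩
      obtain ⟨rfl, z, hz⟩ := h.mem_dom.1 hxy
      exact ⟨rfl, _, x, z, c, hc, hz, rfl, rfl⟩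
    · rintro ⟨huv, w, x, y, c, hc, hxy, hu, -⟩
      exact ⟨x, x, c, hc, h.mem_dom.2 ⟨rfl, y, hxy⟩, hu, hu.trans huv⟩
  · rintro a
    ext ⟨u, v⟩
    constructor
    · rintro ⟨x, y, c, hc, hxy, rfl, rfl⟩
      obtain ⟨rfl, z, hz⟩ := h.mem_ran.1 hxy
      obtain ⟨c', hc', hcode⟩ := h.exists_separates_extend hz hc
      exact ⟨rfl, _, z, x, c', hc', hz, rfl, congrArg e hcode⟩
    · rintro ⟨huv, w, x, y, c, hc, hxy, -, hv⟩
      exact ⟨y, y, c, h.separates_of_mem hxy hc, h.mem_ran.2 ⟨rfl, x, hxy⟩, hv.trans huv.symm, hv⟩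

end IsRepDR

/-- The finite representation property for the signature
{composition, intersection, domain, range}. -/
theorem frp_comp_meet_dom_ran {A : Type*} [Fintype A]
    (star meet : A → A → A) (d r : A → A)
    (h : ∃ (X : Type u) (θ : A → Set (X × X)), IsRepDR star meet d r θ) :
    ∃ (Y : Type v) (_ : Fintype Y) (θ : A → Set (Y × Y)), IsRepDR star meet d r θ := by
  obtain ⟨X, θ, h⟩ := h
  obtain ⟨n, ⟨e⟩⟩ := Finite.exists_equiv_fin (Option A × (A → Set (Option A)))
  exact ⟨ULift (Fin n), inferInstance, codeRep θ (ULift.up ∘ e),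
    h.codeRep_isRepDR (ULift.up_injective.comp e.injective)⟩
end

section
/- Let A be a finite type equipped with binary operations ⋆, ⊓, ⊔, unary operations d, r, ad, fix, mi, and constants z and e. If there exist a type X and a representation of A by partial functions on X (for the signature {composition, intersection, domain, range, zero, identity, antidomain, fixset, preferential union, maximum iterate}), then there exist a finite type Y and such a representation on Y. (The finite representation property for this signature.) -/
universe u v w

/-- Representation for the signature {composition, intersection, preferential union, domain,
range, antidomain, fixset, maximum iterate, zero, identity}. -/
def IsRepBig {A : Type*} {X : Type u} (star meet pref : A → A → A)
    (d r ad fix mi : A → A) (z e : A) (θ : A → Set (X × X)) : Prop :=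
  Function.Injective θ ∧ (∀ a, Functional (θ a)) ∧
  (∀ a b, θ (star a b) = pComp (θ a) (θ b)) ∧
  (∀ a b, θ (meet a b) = θ a ∩ θ b) ∧
  (∀ a b, θ (pref a b) = pPref (θ a) (θ b)) ∧
  (∀ a, θ (d a) = pDom (θ a)) ∧
  (∀ a, θ (r a) = pRan (θ a)) ∧
  (∀ a, θ (ad a) = pAnti (θ a)) ∧
  (∀ a, θ (fix a) = pFix (θ a)) ∧
  (∀ a, θ (mi a) = pMaxIter (θ a)) ∧
  θ z = (∅ : Set (X × X)) ∧
  θ e = pId X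

section Cover

variable {A : Type*} {X : Type u} {Y : Type v} {K : Type*}
  {star meet pref : A → A → A} {d r ad fix mi : A → A} {z e : A}

/-- The powers of an element, taken inside the algebra. -/
def algPow (star : A → A → A) (e a : A) : ℕ → A
  | 0 => e
  | n + 1 => star a (algPow star e a n)

theorem rep_algPow {θ : A → Set (X × X)} (hstar : ∀ a b, θ (star a b) = pComp (θ a) (θ b))
    (he : θ e = pId X) (a : A) (n : ℕ) : θ (algPow star e a n) = pPow (θ a) n := by
  induction n with
  | zero => exact he
  | succ n ih => rw [algPow, hstar, ih, pPow]

theorem mem_pMaxIter_iff {θ : A → Set (X × X)}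
    (hstar : ∀ a b, θ (star a b) = pComp (θ a) (θ b)) (hanti : ∀ a, θ (ad a) = pAnti (θ a))
    (he : θ e = pId X) (a : A) (p : X × X) :
    p ∈ pMaxIter (θ a) ↔ ∃ n, p ∈ θ (star (algPow star e a n) (ad a)) := by
  simp only [pMaxIter, Set.mem_iUnion, hstar, hanti, rep_algPow hstar he]

/-- A representation transfers along a family of partial coverings `C · · k`, each of which
is compatible with steps, and which together lift predecessors. -/
theorem IsRepBig.of_cover {θ : A → Set (X × X)}
    (h : IsRepBig star meet pref d r ad fix mi z e θ)
    (θ' : A → Set (Y × Y)) (C : Y → X → K → Prop)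
    (hY : ∀ y, ∃ x k, C y x k) (hX : ∀ x, ∃ y k, C y x k)
    (huniq : ∀ {y y' x k}, C y x k → C y' x k → y = y')
    (hstep : ∀ {y x x' k a}, C y x k → (x, x') ∈ θ a → ∃ y', C y' x' k)
    (hinj : ∀ {y y' x x' x'' k a b}, C y x k → (x, x') ∈ θ a → (x, x'') ∈ θ b →
      C y' x' k → C y' x'' k → x' = x'')
    (hback : ∀ {y x x' k a}, C y x k → (x', x) ∈ θ a → ∃ y' k', C y' x' k' ∧ C y x k')
    (hmem : ∀ {y x k}, C y x k →
      ∀ a y', (y, y') ∈ θ' a ↔ ∃ x', (x, x') ∈ θ a ∧ C y' x' k) :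
    IsRepBig star meet pref d r ad fix mi z e θ' := by
  obtain ⟨hθ, hfun, hstar, hmeet, hpref, hdom, hran, hanti, hfix, hmi, hz, he⟩ := h
  have hid : ∀ x, (x, x) ∈ θ e := fun x => by rw [he]; rfl
  have hdef : ∀ {y x k}, C y x k → ∀ a, (∃ y', (y, y') ∈ θ' a) ↔ ∃ x', (x, x') ∈ θ a := by
    intro y x k hc a
    constructor
    · rintro ⟨y', hy'⟩
      obtain ⟨x', hx', -⟩ := (hmem hc a y').1 hy'
      exact ⟨x', hx'⟩
    · rintro ⟨x', hx'⟩
      obtain ⟨y', hy'⟩ := hstep hc hx'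
      exact ⟨y', (hmem hc a y').2 ⟨x', hx', hy'⟩⟩
  have hmem' : ∀ {y y' x x' k a}, C y x k → (x, x') ∈ θ a → C y' x' k →
      ∀ b, (y, y') ∈ θ' b ↔ (x, x') ∈ θ b := by
    intro y y' x x' k a hc hx' hc' b
    constructor
    · intro hb
      obtain ⟨x'', hx'', hc''⟩ := (hmem hc b y').1 hb
      rwa [hinj hc hx' hx'' hc' hc'']
    · intro hb
      exact (hmem hc b y').2 ⟨x', hb, hc'⟩
  have hdiag : ∀ {y x k}, C y x k → ∀ b, (y, y) ∈ θ' b ↔ (x, x) ∈ θ b :=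
    fun hc => hmem' hc (hid _) hc
  have hsub : ∀ {a}, (∀ x x', (x, x') ∈ θ a → x = x') → ∀ {y y'}, (y, y') ∈ θ' a → y = y' := by
    intro a ha y y' hyy
    obtain ⟨x, k, hc⟩ := hY y
    obtain ⟨x', hx', hc'⟩ := (hmem hc a y').1 hyy
    obtain rfl := ha _ _ hx'
    exact huniq hc hc'
  have hstar' : ∀ a b, θ' (star a b) = pComp (θ' a) (θ' b) := by
    intro a b
    ext ⟨y, y''⟩
    obtain ⟨x, k, hc⟩ := hY y
    rw [hmem hc, hstar]
    constructor
    · rintro ⟨x'', ⟨x', h1, h2⟩, hc''⟩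
      obtain ⟨y', hc'⟩ := hstep hc h1
      exact ⟨y', (hmem hc a y').2 ⟨x', h1, hc'⟩, (hmem hc' b y'').2 ⟨x'', h2, hc''⟩⟩
    · rintro ⟨y', h1, h2⟩
      obtain ⟨x', h1, hc'⟩ := (hmem hc a y').1 h1
      obtain ⟨x'', h2, hc''⟩ := (hmem hc' b y'').1 h2
      exact ⟨x'', ⟨x', h1, h2⟩, hc''⟩
  have he' : θ' e = pId Y := by
    ext ⟨y, y'⟩
    obtain ⟨x, k, hc⟩ := hY y
    constructor
    · exact hsub fun x x' hx => by rw [he] at hx; exact hx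
    · rintro (rfl : y = y')
      exact (hdiag hc e).2 (hid x)
  have hanti' : ∀ a, θ' (ad a) = pAnti (θ' a) := by
    intro a
    ext ⟨y, y'⟩
    obtain ⟨x, k, hc⟩ := hY y
    have key : (y, y) ∈ θ' (ad a) ↔ ¬∃ w, (y, w) ∈ θ' a := by
      rw [hdiag hc, hdef hc, hanti]; simp [pAnti]
    constructor
    · intro hy
      obtain rfl : y = y' := hsub (fun x x' hx => by rw [hanti] at hx; exact hx.1) hy
      exact ⟨rfl, key.1 hy⟩
    · rintro ⟨rfl : y = y', hy⟩
      exact key.2 hy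
  refine ⟨?_, ?_, hstar', ?_, ?_, ?_, ?_, hanti', ?_, ?_, ?_, he'⟩
  · intro a b hab
    apply hθ
    ext ⟨x, x'⟩
    obtain ⟨y, k, hc⟩ := hX x
    constructor
    · intro hx
      obtain ⟨y', hc'⟩ := hstep hc hx
      exact (hmem' hc hx hc' b).1 (hab ▸ (hmem' hc hx hc' a).2 hx)
    · intro hx
      obtain ⟨y', hc'⟩ := hstep hc hx
      exact (hmem' hc hx hc' a).1 (hab ▸ (hmem' hc hx hc' b).2 hx)
  · intro a y y₁ y₂ h1 h2
    obtain ⟨x, k, hc⟩ := hY y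
    obtain ⟨x₁, h1, hc1⟩ := (hmem hc a y₁).1 h1
    obtain ⟨x₂, h2, hc2⟩ := (hmem hc a y₂).1 h2
    obtain rfl := hfun a _ _ _ h1 h2
    exact huniq hc1 hc2
  · intro a b
    ext ⟨y, y'⟩
    obtain ⟨x, k, hc⟩ := hY y
    constructor
    · intro hy
      obtain ⟨x', hx', hc'⟩ := (hmem hc _ y').1 hy
      rw [hmeet] at hx'
      exact ⟨(hmem hc a y').2 ⟨x', hx'.1, hc'⟩, (hmem hc b y').2 ⟨x', hx'.2, hc'⟩⟩
    · rintro ⟨h1, h2⟩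
      obtain ⟨x', h1, hc'⟩ := (hmem hc a y').1 h1
      rw [hmem' hc h1 hc'] at h2 ⊢
      rw [hmeet]
      exact ⟨h1, h2⟩
  · intro a b
    ext ⟨y, y'⟩
    obtain ⟨x, k, hc⟩ := hY y
    change _ ↔ (y, y') ∈ θ' a ∨ (y, y') ∈ θ' b ∧ ¬∃ w, (y, w) ∈ θ' a
    rw [hdef hc, hmem hc, hmem hc, hmem hc, hpref]
    constructor
    · rintro ⟨x', hx' | ⟨hx', hn⟩, hc'⟩
      · exact Or.inl ⟨x', hx', hc'⟩
      · exact Or.inr ⟨⟨x', hx', hc'⟩, hn⟩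
    · rintro (⟨x', hx', hc'⟩ | ⟨⟨x', hx', hc'⟩, hn⟩)
      · exact ⟨x', Or.inl hx', hc'⟩
      · exact ⟨x', Or.inr ⟨hx', hn⟩, hc'⟩
  · intro a
    ext ⟨y, y'⟩
    obtain ⟨x, k, hc⟩ := hY y
    have key : (y, y) ∈ θ' (d a) ↔ ∃ w, (y, w) ∈ θ' a := by
      rw [hdiag hc, hdef hc, hdom]; simp [pDom]
    constructor
    · intro hy
      obtain rfl : y = y' := hsub (fun x x' hx => by rw [hdom] at hx; exact hx.1) hy
      exact ⟨rfl, key.1 hy⟩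
    · rintro ⟨rfl : y = y', hy⟩
      exact key.2 hy
  · intro a
    ext ⟨y, y'⟩
    have key : (y, y) ∈ θ' (r a) ↔ ∃ w, (w, y) ∈ θ' a := by
      constructor
      · obtain ⟨x, k, hc⟩ := hY y
        rw [hdiag hc, hran]
        rintro ⟨-, x', hx'⟩
        obtain ⟨y', k', hc', hc''⟩ := hback hc hx'
        exact ⟨y', (hmem hc' a y).2 ⟨x, hx', hc''⟩⟩
      · rintro ⟨w, hw⟩
        obtain ⟨x', k, hc'⟩ := hY w
        obtain ⟨x, hx, hc⟩ := (hmem hc' a y).1 hw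
        rw [hdiag hc, hran]
        exact ⟨rfl, x', hx⟩
    constructor
    · intro hy
      obtain rfl : y = y' := hsub (fun x x' hx => by rw [hran] at hx; exact hx.1) hy
      exact ⟨rfl, key.1 hy⟩
    · rintro ⟨rfl : y = y', hy⟩
      exact key.2 hy
  · intro a
    ext ⟨y, y'⟩
    obtain ⟨x, k, hc⟩ := hY y
    have key : (y, y) ∈ θ' (fix a) ↔ (y, y) ∈ θ' a := by
      rw [hdiag hc, hdiag hc, hfix]; simp [pFix]
    constructor
    · intro hy
      obtain rfl : y = y' := hsub (fun x x' hx => by rw [hfix] at hx; exact hx.1) hy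
      exact ⟨rfl, key.1 hy⟩
    · rintro ⟨rfl : y = y', hy⟩
      exact key.2 hy
  · intro a
    ext ⟨y, y'⟩
    obtain ⟨x, k, hc⟩ := hY y
    rw [mem_pMaxIter_iff hstar' hanti' he', hmem hc]
    simp only [hmem hc, hmi, mem_pMaxIter_iff hstar hanti he]
    constructor
    · rintro ⟨x', ⟨n, hn⟩, hc'⟩
      exact ⟨n, x', hn, hc'⟩
    · rintro ⟨n, x', hn, hc'⟩
      exact ⟨x', ⟨n, hn⟩, hc'⟩
  · rw [Set.eq_empty_iff_forall_notMem]
    rintro ⟨y, y'⟩ hy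
    obtain ⟨x, k, hc⟩ := hY y
    obtain ⟨x', hx', -⟩ := (hmem hc z y').1 hy
    rwa [hz] at hx'

end Cover

section Coloring

variable {A : Type*} {X : Type u}

/-- `c` records, for each element `b`, the colour under `col` of the image of `x` under `θ b`
(if there is one), where `col` distinguishes the points in the future of `x`. -/
def Codes (θ : A → Set (X × X)) (c : A → Option A) (x : X) (col : X → A) : Prop :=
  Set.InjOn col (future θ x) ∧ ∀ b k, c b = some k ↔ ∃ p, (x, p) ∈ θ b ∧ col p = k

theorem Codes.unique {θ : A → Set (X × X)} {c c' : A → Option A} {x : X} {col : X → A}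
    (h : Codes θ c x col) (h' : Codes θ c' x col) : c = c' := by
  funext b
  ext k
  rw [h.2, h'.2]

theorem exists_codes {θ : A → Set (X × X)} (hfun : ∀ a, Functional (θ a)) {x : X} {col : X → A}
    (h : Set.InjOn col (future θ x)) : ∃ c, Codes θ c x col := by
  classical
  refine ⟨fun b => if hb : ∃ p, (x, p) ∈ θ b then some (col hb.choose) else none, h, ?_⟩
  intro b k
  by_cases hb : ∃ p, (x, p) ∈ θ b
  · simp only [dif_pos hb, Option.some.injEq]
    constructor
    · exact fun hk => ⟨_, hb.choose_spec, hk⟩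
    · rintro ⟨p, hp, rfl⟩
      rw [hfun b _ _ _ hb.choose_spec hp]
  · simp only [dif_neg hb]
    grind

theorem future_subset {θ : A → Set (X × X)} {star : A → A → A}
    (hstar : ∀ a b, θ (star a b) = pComp (θ a) (θ b)) {x x' : X} {a : A} (h : (x, x') ∈ θ a) :
    future θ x' ⊆ future θ x := by
  rintro p ⟨b, hb⟩
  exact ⟨star a b, by rw [hstar]; exact ⟨x', h, hb⟩⟩

theorem Codes.step {θ : A → Set (X × X)} {star : A → A → A} (hfun : ∀ a, Functional (θ a))
    (hstar : ∀ a b, θ (star a b) = pComp (θ a) (θ b)) {c : A → Option A} {x x' : X}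
    {col : X → A} {a : A} (h : Codes θ c x col) (hx : (x, x') ∈ θ a) :
    Codes θ (fun b => c (star a b)) x' col := by
  refine ⟨h.1.mono (future_subset hstar hx), fun b k => ?_⟩
  rw [h.2, hstar]
  constructor
  · rintro ⟨p, ⟨q, h1, h2⟩, hk⟩
    obtain rfl := hfun a _ _ _ h1 hx
    exact ⟨p, h2, hk⟩
  · rintro ⟨p, hp, hk⟩
    exact ⟨p, ⟨x', hx, hp⟩, hk⟩

theorem exists_injOn_future [Nonempty A] {θ : A → Set (X × X)} (hfun : ∀ a, Functional (θ a))
    (x : X) : ∃ col : X → A, Set.InjOn col (future θ x) := by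
  classical
  have hlab : ∀ p, ∃ b, p ∈ future θ x → (x, p) ∈ θ b := fun p => by
    by_cases hp : p ∈ future θ x
    · exact ⟨hp.choose, fun _ => hp.choose_spec⟩
    · exact ⟨Classical.arbitrary A, fun h => absurd h hp⟩
  choose lab hlab using hlab
  refine ⟨lab, fun p hp q hq hpq => ?_⟩
  exact hfun _ _ _ _ (hlab p hp) (hpq ▸ hlab q hq)

/-- An injective colouring of a subset extends to any superset that can be injectively
coloured with the same finite set of colours. -/
theorem exists_injOn_extend [Finite A] {S T : Set X} (hST : S ⊆ T) {f g : X → A}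
    (hf : Set.InjOn f S) (hg : Set.InjOn g T) :
    ∃ f' : X → A, Set.InjOn f' T ∧ Set.EqOn f' f S := by
  classical
  have := Fintype.ofFinite A
  rcases S.eq_empty_or_nonempty with rfl | ⟨p₀, -⟩
  · exact ⟨g, hg, fun _ h => h.elim⟩
  have : Nonempty X := ⟨p₀⟩
  have hgS := hg.mono hST
  have hinv : ∀ p ∈ S, Function.invFunOn g S (g p) = p := fun p hp =>
    hgS.leftInvOn_invFunOn hp
  have hcard : Fintype.card A = (Finset.univ : Finset A).card := Finset.card_univ.symm
  obtain ⟨σ, hσ⟩ := Finset.exists_equiv_extend_of_card_eq hcard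
    (s := (g '' S).toFinset) (f := fun a => f (Function.invFunOn g S a))
    (Finset.subset_univ _) (by
      rw [Set.coe_toFinset]
      rintro _ ⟨p, hp, rfl⟩ _ ⟨q, hq, rfl⟩ hpq
      simp only [hinv p hp, hinv q hq] at hpq
      rw [hf hp hq hpq])
  refine ⟨fun p => σ (g p), fun p hp q hq hpq => ?_, fun p hp => ?_⟩
  · exact hg hp hq (σ.injective (Subtype.ext hpq))
  · have := hσ (g p) (by simpa using ⟨p, hp, rfl⟩)
    simpa only [hinv p hp] using this

theorem Codes.back [Finite A] {θ : A → Set (X × X)} {star : A → A → A}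
    (hfun : ∀ a, Functional (θ a)) (hstar : ∀ a b, θ (star a b) = pComp (θ a) (θ b))
    {c : A → Option A} {x x' : X} {col : X → A} {a : A} (h : Codes θ c x col)
    (hx : (x', x) ∈ θ a) : ∃ c' col', Codes θ c' x' col' ∧ Codes θ c x col' := by
  have : Nonempty A := ⟨a⟩
  have hsub := future_subset hstar hx
  obtain ⟨g, hg⟩ := exists_injOn_future hfun x'
  obtain ⟨col', hinj, heq⟩ := exists_injOn_extend hsub h.1 hg
  obtain ⟨c', hc'⟩ := exists_codes hfun hinj
  refine ⟨c', col', hc', hinj.mono hsub, fun b k => ?_⟩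
  rw [h.2]
  refine exists_congr fun p => and_congr_right fun hp => ?_
  rw [heq ⟨b, hp⟩]

theorem Codes.mem_iff {θ : A → Set (X × X)} {star : A → A → A} (hfun : ∀ a, Functional (θ a))
    (hstar : ∀ a b, θ (star a b) = pComp (θ a) (θ b)) {c : A → Option A} {x : X}
    {col : X → A} (h : Codes θ c x col) (a : A) (c' : A → Option A) :
    (c a ≠ none ∧ c' = fun b => c (star a b)) ↔ ∃ x', (x, x') ∈ θ a ∧ Codes θ c' x' col := by
  constructor
  · rintro ⟨ha, rfl⟩
    obtain ⟨k, hk⟩ := Option.ne_none_iff_exists'.1 ha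
    obtain ⟨x', hx', -⟩ := (h.2 a k).1 hk
    exact ⟨x', hx', h.step hfun hstar hx'⟩
  · rintro ⟨x', hx', hc'⟩
    refine ⟨?_, hc'.unique (h.step hfun hstar hx')⟩
    rw [(h.2 a (col x')).2 ⟨x', hx', rfl⟩]
    exact Option.some_ne_none _

end Coloring

/-- The finite representation property for the signature {composition, intersection,
domain, range, zero, identity, antidomain, fixset, preferential union, maximum iterate}. -/
theorem frp_big {A : Type*} [Fintype A]
    (star meet pref : A → A → A) (d r ad fix mi : A → A) (z e : A)
    (h : ∃ (X : Type u) (θ : A → Set (X × X)), IsRepBig star meet pref d r ad fix mi z e θ) :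
    ∃ (Y : Type v) (_ : Fintype Y) (θ : A → Set (Y × Y)),
      IsRepBig star meet pref d r ad fix mi z e θ := by
  obtain ⟨X, θ, h⟩ := h
  obtain ⟨-, hfun, hstar, -, -, -, -, -, -, -, -, he⟩ := id h
  have : Nonempty A := ⟨e⟩
  obtain ⟨n, ⟨equiv⟩⟩ := Finite.exists_equiv_fin {c : A → Option A // ∃ x col, Codes θ c x col}
  let code := (Equiv.ulift.{v}.trans equiv.symm : ULift.{v} (Fin n) ≃ _)
  have hcode : ∀ {c x col}, Codes θ c x col → ∃ y, (code y).1 = c := fun {c x col} hc =>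
    ⟨code.symm ⟨c, x, col, hc⟩, by rw [Equiv.apply_symm_apply]⟩
  refine ⟨ULift.{v} (Fin n), inferInstance,
    fun a => {p | (code p.1).1 a ≠ none ∧ (code p.2).1 = fun b => (code p.1).1 (star a b)},
    h.of_cover _ (fun y x col => Codes θ (code y).1 x col)
      (fun y => (code y).2) ?_ ?_ ?_ ?_ ?_ ?_⟩
  · intro x
    obtain ⟨col, hcol⟩ := exists_injOn_future hfun x
    obtain ⟨c, hc⟩ := exists_codes hfun hcol
    obtain ⟨y, rfl⟩ := hcode hc
    exact ⟨y, col, hc⟩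
  · intro y y' x col hc hc'
    exact code.injective (Subtype.ext (hc.unique hc'))
  · intro y x x' col a hc hx
    have hc' := hc.step hfun hstar hx
    obtain ⟨y', hy'⟩ := hcode hc'
    exact ⟨y', by rw [hy']; exact hc'⟩
  · intro y y' x x' x'' col a b hc hx' hx'' hc' hc''
    have h1 := (hc'.2 e _).2 ⟨x', by rw [he]; rfl, rfl⟩
    have h2 := (hc''.2 e _).2 ⟨x'', by rw [he]; rfl, rfl⟩
    exact hc.1 ⟨a, hx'⟩ ⟨b, hx''⟩ (Option.some.inj (h1.symm.trans h2))
  · intro y x x' col a hc hx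
    obtain ⟨c', col', hc', hc''⟩ := hc.back hfun hstar hx
    obtain ⟨y', rfl⟩ := hcode hc'
    exact ⟨y', col', hc', hc''⟩
  · intro y x col hc a y'
    exact hc.mem_iff hfun hstar a (code y').1
end

section
/- Let A be a finite type equipped with binary operations ⋆, ⊓, ⊔, unary operations d, r, ad, fix, mi, op, and constants z and e. If there exist a type X and a representation of A by partial functions on X (for the signature {composition, intersection, domain, range, zero, identity, antidomain, fixset, preferential union, maximum iterate, opposite}), then there exist a finite type Y and such a representation on Y. (The finite representation property for the full signature including opposite.) -/
universe u v w

/-- Representation for the full signature {composition, intersection, preferential union,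
domain, range, antidomain, fixset, maximum iterate, opposite, zero, identity}. -/
def IsRepFull {A : Type*} {X : Type u} (star meet pref : A → A → A)
    (d r ad fix mi op : A → A) (z e : A) (θ : A → Set (X × X)) : Prop :=
  Function.Injective θ ∧ (∀ a, Functional (θ a)) ∧
  (∀ a b, θ (star a b) = pComp (θ a) (θ b)) ∧
  (∀ a b, θ (meet a b) = θ a ∩ θ b) ∧
  (∀ a b, θ (pref a b) = pPref (θ a) (θ b)) ∧
  (∀ a, θ (d a) = pDom (θ a)) ∧
  (∀ a, θ (r a) = pRan (θ a)) ∧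
  (∀ a, θ (ad a) = pAnti (θ a)) ∧
  (∀ a, θ (fix a) = pFix (θ a)) ∧
  (∀ a, θ (mi a) = pMaxIter (θ a)) ∧
  (∀ a, θ (op a) = pOpp (θ a)) ∧
  θ z = (∅ : Set (X × X)) ∧
  θ e = pId X

/-- A partial labelling whose kernel is that of an equivalence relation extends to a labelling
of a finite type with exactly that kernel, provided there are enough labels. -/
theorem exists_extension_with_kernel {A B N : Type*} [Fintype A] [Fintype N] (s : Setoid A)
    (hcard : Fintype.card A ≤ Fintype.card N) (g : B → A) (f : B → N)
    (hf : ∀ b b', f b = f b' ↔ s (g b) (g b')) :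
    ∃ c : A → N, (∀ h h', c h = c h' ↔ s h h') ∧ ∀ b, c (g b) = f b := by
  classical
  by_cases hA : IsEmpty A
  · exact ⟨fun a => hA.elim a, fun a => hA.elim a, fun b => hA.elim (g b)⟩
  rw [not_isEmpty_iff] at hA
  have hN : Nonempty N := Fintype.card_pos_iff.mp (Fintype.card_pos.trans_le hcard)
  let F : Quotient s → N := fun q =>
    if h : ∃ b, (⟦g b⟧ : Quotient s) = q then f h.choose else Classical.arbitrary N
  have hF : ∀ b, F ⟦g b⟧ = f b := by
    intro b
    have h : ∃ b', (⟦g b'⟧ : Quotient s) = ⟦g b⟧ := ⟨b, rfl⟩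
    simp only [F, dif_pos h]
    exact (hf _ _).2 (Quotient.exact h.choose_spec)
  let S : Finset (Quotient s) := {q | ∃ b, (⟦g b⟧ : Quotient s) = q}
  have hS : Set.InjOn F S := by
    intro p hp q hq hpq
    obtain ⟨b, rfl⟩ : ∃ b, (⟦g b⟧ : Quotient s) = p := by simpa [S] using hp
    obtain ⟨b', rfl⟩ : ∃ b, (⟦g b⟧ : Quotient s) = q := by simpa [S] using hq
    rw [hF, hF] at hpq
    exact Quotient.sound ((hf _ _).1 hpq)
  have hle : (S.image F).card ≤ Fintype.card (Quotient s) :=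
    Finset.card_image_le.trans (Finset.card_le_univ S)
  obtain ⟨t, ht, -, htc⟩ := Finset.exists_subsuperset_card_eq (Finset.subset_univ (S.image F))
    hle ((Fintype.card_quotient_le s).trans hcard)
  obtain ⟨G, hG⟩ := Finset.exists_equiv_extend_of_card_eq htc.symm ht hS
  refine ⟨fun a => G ⟦a⟧, fun h h' => ?_, fun b => ?_⟩
  · rw [Subtype.coe_inj, G.injective.eq_iff]
    exact Quotient.eq
  · rw [← hF b]
    exact hG _ (by simp [S])

/-- Two elements agree at `x` if the functions representing them have the same value at `x`, or
are both undefined there. -/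
def agreeAt {A : Type*} {X : Type u} (θ : A → Set (X × X)) (x : X) : Setoid A where
  r a b := ∀ y, (x, y) ∈ θ a ↔ (x, y) ∈ θ b
  iseqv := ⟨fun _ _ => Iff.rfl, fun h y => (h y).symm, fun h h' y => (h y).trans (h' y)⟩

theorem agreeAt_of_mem {A : Type*} {X : Type u} {θ : A → Set (X × X)}
    (hfun : ∀ a, Functional (θ a)) {a b : A} {x y : X} (ha : (x, y) ∈ θ a) (hb : (x, y) ∈ θ b) :
    agreeAt θ x a b := fun _ =>
  ⟨fun h => hfun a _ _ _ ha h ▸ hb, fun h => hfun b _ _ _ hb h ▸ ha⟩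

/-- The representation on labellings: `a` sends the labelling `c` to `fun h => c (star a h)`, and
is undefined at `c` when `c` gives `a` the label of `z`. -/
def labellingRep {A N : Type*} {Y : Type v} (star : A → A → A) (z : A) (c : Y → A → N) (a : A) :
    Set (Y × Y) :=
  {p | c p.1 a ≠ c p.1 z ∧ ∀ h, c p.2 h = c p.1 (star a h)}

/-- If the labellings are exactly the functions whose kernel is agreement at some point of a
representation, and there are more labels than elements, they carry a representation. -/
theorem IsRepFull.labellingRep {A N : Type*} [Fintype A] [Fintype N] {X : Type u} {Y : Type v}
    {star meet pref : A → A → A} {d r ad fix mi op : A → A} {z e : A} {θ : A → Set (X × X)}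
    (hθ : IsRepFull star meet pref d r ad fix mi op z e θ)
    (hcard : Fintype.card A < Fintype.card N) (c : Y → A → N) (hc : Function.Injective c)
    (hrange : ∀ f, (∃ p, c p = f) ↔ ∃ x, ∀ h h', f h = f h' ↔ agreeAt θ x h h') :
    IsRepFull star meet pref d r ad fix mi op z e (labellingRep star z c) := by
  classical
  obtain ⟨hinj, hfun, hstar, hmeet, hpref, hd, hr, had, hfix, hmi, hop, hz, he⟩ := hθ
  have mstar : ∀ {a b x y}, (x, y) ∈ θ (star a b) ↔ ∃ w, (x, w) ∈ θ a ∧ (w, y) ∈ θ b := by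
    intro a b x y; rw [hstar]; rfl
  have mz : ∀ {x y}, (x, y) ∉ θ z := by
    intro x y; rw [hz]; exact id
  have me : ∀ {x y}, (x, y) ∈ θ e ↔ x = y := by
    intro x y; rw [he]; rfl
  have md : ∀ {a x y}, (x, y) ∈ θ (d a) ↔ x = y ∧ ∃ w, (x, w) ∈ θ a := by
    intro a x y; rw [hd]; rfl
  have mr : ∀ {a x y}, (x, y) ∈ θ (r a) ↔ x = y ∧ ∃ w, (w, y) ∈ θ a := by
    intro a x y; rw [hr]; rfl
  have mad : ∀ {a x y}, (x, y) ∈ θ (ad a) ↔ x = y ∧ ¬∃ w, (x, w) ∈ θ a := by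
    intro a x y; rw [had]; rfl
  have mfix : ∀ {a x y}, (x, y) ∈ θ (fix a) ↔ x = y ∧ (x, x) ∈ θ a := by
    intro a x y; rw [hfix]; rfl
  have mmeet : ∀ {a b x y}, (x, y) ∈ θ (meet a b) ↔ (x, y) ∈ θ a ∧ (x, y) ∈ θ b := by
    intro a b x y; rw [hmeet]; rfl
  have mpref : ∀ {a b x y}, (x, y) ∈ θ (pref a b) ↔
      (x, y) ∈ θ a ∨ ((x, y) ∈ θ b ∧ ¬∃ w, (x, w) ∈ θ a) := by
    intro a b x y; rw [hpref]; rfl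
  have mop : ∀ {a x y}, (x, y) ∈ θ (op a) ↔ (y, x) ∈ θ a ∧ ∀ w, (w, x) ∈ θ a → w = y := by
    intro a x y; rw [hop]; rfl
  have assoc : ∀ a b b', star (star a b) b' = star a (star b b') := by
    intro a b b'
    apply hinj
    ext ⟨x, y⟩
    simp only [mstar]
    tauto
  have e_star : ∀ a, star e a = a := by
    intro a
    apply hinj
    ext ⟨x, y⟩
    simp [mstar, me]
  have star_e : ∀ a, star a e = a := by
    intro a
    apply hinj
    ext ⟨x, y⟩
    simp [mstar, me]
  have star_z : ∀ a, star a z = z := by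
    intro a
    apply hinj
    ext ⟨x, y⟩
    simp [mstar, mz]
  have point : ∀ p, ∃ x, ∀ h h', c p h = c p h' ↔ agreeAt θ x h h' :=
    fun p => (hrange _).1 ⟨p, rfl⟩
  have agree_z : ∀ {a x}, agreeAt θ x a z ↔ ¬∃ w, (x, w) ∈ θ a := by
    intro a x
    refine ⟨fun h ⟨w, hw⟩ => mz ((h w).1 hw), fun h y => ?_⟩
    exact ⟨fun hy => (h ⟨y, hy⟩).elim, fun hy => (mz hy).elim⟩
  have ne_z : ∀ {p x}, (∀ h h', c p h = c p h' ↔ agreeAt θ x h h') →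
      ∀ a, c p a ≠ c p z ↔ ∃ w, (x, w) ∈ θ a := by
    intro p x hx a
    rw [Ne, hx, agree_z, not_not]
  have agree_star : ∀ {a b x}, agreeAt θ x a b → ∀ h, agreeAt θ x (star a h) (star b h) := by
    intro a b x hab h y
    rw [mstar, mstar]
    exact exists_congr fun w => and_congr_left fun _ => hab w
  have agree_star_iff : ∀ {a x y}, (x, y) ∈ θ a → ∀ h h',
      agreeAt θ x (star a h) (star a h') ↔ agreeAt θ y h h' := by
    intro a x y hxy h h'
    have key : ∀ h w, (x, w) ∈ θ (star a h) ↔ (y, w) ∈ θ h := by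
      intro h w
      rw [mstar]
      exact ⟨fun ⟨v, hv, hw⟩ => hfun a _ _ _ hxy hv ▸ hw, fun hw => ⟨y, hxy, hw⟩⟩
    exact forall_congr' fun w => by rw [key, key]
  have image_point : ∀ {p q x y a}, (∀ h h', c p h = c p h' ↔ agreeAt θ x h h') →
      (x, y) ∈ θ a → (∀ h, c q h = c p (star a h)) →
      ∀ h h', c q h = c q h' ↔ agreeAt θ y h h' := by
    intro p q x y a hx hxy hq h h'
    rw [hq, hq, hx, agree_star_iff hxy]
  have exists_image : ∀ {p x y a}, (∀ h h', c p h = c p h' ↔ agreeAt θ x h h') →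
      (x, y) ∈ θ a → ∃ q, ∀ h, c q h = c p (star a h) := by
    intro p x y a hx hxy
    obtain ⟨q, hq⟩ := (hrange fun h => c p (star a h)).2
      ⟨y, fun h h' => by rw [hx, agree_star_iff hxy]⟩
    exact ⟨q, fun h => congrFun hq h⟩
  have exists_preimage : ∀ {q x y a}, (∀ h h', c q h = c q h' ↔ agreeAt θ y h h') →
      (x, y) ∈ θ a → ∃ p, (∀ h h', c p h = c p h' ↔ agreeAt θ x h h') ∧
        ∀ h, c q h = c p (star a h) := by
    intro q x y a hy hxy
    obtain ⟨f, hf, hfa⟩ := exists_extension_with_kernel (agreeAt θ x) hcard.le (star a) (c q)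
      (fun h h' => by rw [hy, agree_star_iff hxy])
    obtain ⟨p, rfl⟩ := (hrange f).2 ⟨x, hf⟩
    exact ⟨p, hf, fun h => (hfa h).symm⟩
  have exists_at : ∀ x, ∃ p, ∀ h h', c p h = c p h' ↔ agreeAt θ x h h' := by
    intro x
    obtain ⟨f, hf, -⟩ := exists_extension_with_kernel (agreeAt θ x) hcard.le
      (fun b : Empty => b.elim) (fun b : Empty => (b.elim : N)) (fun b => b.elim)
    obtain ⟨p, rfl⟩ := (hrange f).2 ⟨x, hf⟩
    exact ⟨p, hf⟩
  set ρ := _root_.labellingRep star z c with hρ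
  have mem : ∀ {a p q}, (p, q) ∈ ρ a ↔ c p a ≠ c p z ∧ ∀ h, c q h = c p (star a h) :=
    Iff.rfl
  have mem_congr : ∀ {p q x a b}, (∀ h h', c p h = c p h' ↔ agreeAt θ x h h') →
      agreeAt θ x a b → ((p, q) ∈ ρ a ↔ (p, q) ∈ ρ b) := by
    intro p q x a b hx hab
    rw [mem, mem, (hx a b).2 hab]
    simp only [(hx _ _).2 (agree_star hab _)]
  have dom : ∀ {p x}, (∀ h h', c p h = c p h' ↔ agreeAt θ x h h') →
      ∀ a, (∃ q, (p, q) ∈ ρ a) ↔ ∃ w, (x, w) ∈ θ a := by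
    intro p x hx a
    constructor
    · rintro ⟨q, hq⟩
      exact (ne_z hx a).1 hq.1
    · rintro ⟨w, hw⟩
      obtain ⟨q, hq⟩ := exists_image hx hw
      exact ⟨q, (ne_z hx a).2 ⟨w, hw⟩, hq⟩
  have point_of_mem : ∀ {p q a x}, (∀ h h', c p h = c p h' ↔ agreeAt θ x h h') →
      (p, q) ∈ ρ a → ∃ y, (x, y) ∈ θ a ∧ ∀ h h', c q h = c q h' ↔ agreeAt θ y h h' := by
    intro p q a x hx hpq
    obtain ⟨y, hy⟩ := (ne_z hx a).1 hpq.1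
    exact ⟨y, hy, image_point hx hy hpq.2⟩
  have mem_e : ∀ {p q}, (p, q) ∈ ρ e ↔ p = q := by
    intro p q
    obtain ⟨x, hx⟩ := point p
    rw [mem]
    simp only [e_star]
    constructor
    · rintro ⟨-, h⟩
      exact hc (funext fun a => (h a).symm)
    · rintro rfl
      exact ⟨(ne_z hx e).2 ⟨x, me.2 rfl⟩, fun _ => rfl⟩
  have mem_subid : ∀ {p q x a}, (∀ h h', c p h = c p h' ↔ agreeAt θ x h h') →
      (∀ y, (x, y) ∈ θ a → x = y) → ((p, q) ∈ ρ a ↔ p = q ∧ (x, x) ∈ θ a) := by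
    intro p q x a hx ha
    constructor
    · intro h
      obtain ⟨y, hy⟩ := (ne_z hx a).1 h.1
      obtain rfl := ha y hy
      exact ⟨mem_e.1 ((mem_congr hx (agreeAt_of_mem hfun hy (me.2 rfl))).1 h), hy⟩
    · rintro ⟨rfl, h⟩
      exact (mem_congr hx (agreeAt_of_mem hfun h (me.2 rfl))).2 (mem_e.2 rfl)
  have ρ_star : ∀ a b, ρ (star a b) = pComp (ρ a) (ρ b) := by
    intro a b
    ext ⟨p, q⟩
    obtain ⟨x, hx⟩ := point p
    constructor
    · rintro ⟨hne, hq⟩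
      obtain ⟨y, hy⟩ := (ne_z hx _).1 hne
      obtain ⟨w, hxw, hwy⟩ := mstar.1 hy
      obtain ⟨s, hs⟩ := exists_image hx hxw
      refine ⟨s, ⟨(ne_z hx a).2 ⟨w, hxw⟩, hs⟩, ?_, fun h => ?_⟩
      · exact (ne_z (image_point hx hxw hs) b).2 ⟨y, hwy⟩
      · exact (hq h).trans (by rw [assoc, hs])
    · rintro ⟨s, ⟨-, hs⟩, hne, hq⟩
      refine ⟨?_, fun h => ?_⟩
      · intro h
        apply hne
        rw [hs, hs, star_z]
        exact h
      · exact (hq h).trans (by rw [hs, assoc])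
  have ρ_ad : ∀ a, ρ (ad a) = pAnti (ρ a) := by
    intro a
    ext ⟨p, q⟩
    obtain ⟨x, hx⟩ := point p
    rw [mem_subid hx fun y hy => (mad.1 hy).1, mad]
    exact and_congr_right fun _ => by rw [dom hx]; simp
  refine ⟨?_, ?_, ρ_star, ?_, ?_, ?_, ?_, ρ_ad, ?_, ?_, ?_, ?_, ?_⟩
  · intro a b hab
    apply hinj
    ext ⟨x, y⟩
    obtain ⟨p, hp⟩ := exists_at x
    suffices h : agreeAt θ x a b from h y
    by_cases hdef : ∃ q, (p, q) ∈ ρ a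
    · obtain ⟨q, hq⟩ := hdef
      have hq' : (p, q) ∈ ρ b := hab ▸ hq
      rw [← hp, ← star_e a, ← star_e b, ← hq.2, ← hq'.2]
    · have hdef' : ¬∃ q, (p, q) ∈ ρ b := hab ▸ hdef
      rw [dom hp, ← agree_z] at hdef hdef'
      exact (agreeAt θ x).trans' hdef ((agreeAt θ x).symm' hdef')
  · intro a p q q' h h'
    exact hc (funext fun b => (h.2 b).trans (h'.2 b).symm)
  · intro a b
    ext ⟨p, q⟩
    obtain ⟨x, hx⟩ := point p
    constructor
    · intro h
      obtain ⟨y, hy⟩ := (ne_z hx _).1 h.1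
      obtain ⟨ha, hb⟩ := mmeet.1 hy
      exact ⟨(mem_congr hx (agreeAt_of_mem hfun hy ha)).1 h,
        (mem_congr hx (agreeAt_of_mem hfun hy hb)).1 h⟩
    · rintro ⟨ha, hb⟩
      obtain ⟨y, hy⟩ := (ne_z hx _).1 ha.1
      have hab : agreeAt θ x a b := by
        rw [← hx, ← star_e a, ← star_e b, ← ha.2, ← hb.2]
      exact (mem_congr hx (agreeAt_of_mem hfun hy (mmeet.2 ⟨hy, (hab y).1 hy⟩))).1 ha
  · intro a b
    ext ⟨p, q⟩
    obtain ⟨x, hx⟩ := point p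
    change _ ↔ (p, q) ∈ ρ a ∨ ((p, q) ∈ ρ b ∧ ¬∃ w, (p, w) ∈ ρ a)
    rw [dom hx]
    by_cases hdef : ∃ w, (x, w) ∈ θ a
    · obtain ⟨w, hw⟩ := hdef
      rw [mem_congr hx (agreeAt_of_mem hfun (mpref.2 (Or.inl hw)) hw)]
      simp only [show ∃ w, (x, w) ∈ θ a from ⟨w, hw⟩, not_true, and_false, or_false]
    · have hab : agreeAt θ x (pref a b) b := fun y => by
        rw [mpref]
        exact ⟨fun h => h.elim (fun h => (hdef ⟨y, h⟩).elim) And.left, fun h => Or.inr ⟨h, hdef⟩⟩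
      have hna : (p, q) ∉ ρ a := fun h => hdef ((dom hx a).1 ⟨q, h⟩)
      rw [mem_congr hx hab]
      simp only [hna, hdef, not_false_eq_true, and_true, false_or]
  · intro a
    ext ⟨p, q⟩
    obtain ⟨x, hx⟩ := point p
    rw [mem_subid hx fun y hy => (md.1 hy).1, md]
    exact and_congr_right fun _ => by rw [dom hx]; simp
  · intro a
    ext ⟨p, q⟩
    obtain ⟨x, hx⟩ := point p
    rw [mem_subid hx fun y hy => (mr.1 hy).1, mr]
    change _ ↔ p = q ∧ ∃ s, (s, q) ∈ ρ a
    constructor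
    · rintro ⟨rfl, -, w, hw⟩
      obtain ⟨s, hs, hsp⟩ := exists_preimage hx hw
      exact ⟨rfl, s, (ne_z hs a).2 ⟨x, hw⟩, hsp⟩
    · rintro ⟨rfl, s, hs⟩
      obtain ⟨w, hw⟩ := point s
      obtain ⟨y, hwy, hy⟩ := point_of_mem hw hs
      have hne := (ne_z hy (r a)).2 ⟨y, mr.2 ⟨rfl, w, hwy⟩⟩
      obtain ⟨v, hv⟩ := (ne_z hx (r a)).1 hne
      obtain ⟨rfl, hv⟩ := mr.1 hv
      exact ⟨rfl, rfl, hv⟩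
  · intro a
    ext ⟨p, q⟩
    obtain ⟨x, hx⟩ := point p
    rw [mem_subid hx fun y hy => (mfix.1 hy).1, mfix]
    change _ ↔ p = q ∧ (p, p) ∈ ρ a
    refine and_congr_right fun _ => ⟨fun h => ?_, fun h => ⟨rfl, ?_⟩⟩
    · exact (mem_congr hx (agreeAt_of_mem hfun h.2 (me.2 rfl))).2 (mem_e.2 rfl)
    · have hae : agreeAt θ x e a := by
        rw [← hx, h.2, star_e]
      exact (hae x).1 (me.2 rfl)
  · intro a
    let pow : ℕ → A := fun n => Nat.rec e (fun _ b => star a b) n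
    have hpowθ : ∀ n, θ (pow n) = pPow (θ a) n := by
      intro n
      induction n with
      | zero => exact he
      | succ n ih => exact (hstar a (pow n)).trans (congrArg _ ih)
    have hpowρ : ∀ n, ρ (pow n) = pPow (ρ a) n := by
      intro n
      induction n with
      | zero =>
        ext ⟨p, q⟩
        exact mem_e
      | succ n ih => exact (ρ_star a (pow n)).trans (congrArg _ ih)
    have mmi : ∀ {x y}, (x, y) ∈ θ (mi a) ↔ ∃ n, (x, y) ∈ θ (star (pow n) (ad a)) := by
      intro x y
      rw [hmi, pMaxIter, Set.mem_iUnion]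
      simp only [hstar, hpowθ, had]
    ext ⟨p, q⟩
    obtain ⟨x, hx⟩ := point p
    rw [pMaxIter, Set.mem_iUnion]
    simp only [← hpowρ, ← ρ_ad, ← ρ_star]
    constructor
    · intro h
      obtain ⟨y, hy⟩ := (ne_z hx _).1 h.1
      obtain ⟨n, hn⟩ := mmi.1 hy
      exact ⟨n, (mem_congr hx (agreeAt_of_mem hfun hy hn)).1 h⟩
    · rintro ⟨n, h⟩
      obtain ⟨y, hy⟩ := (ne_z hx _).1 h.1
      exact (mem_congr hx (agreeAt_of_mem hfun (mmi.2 ⟨n, hy⟩) hy)).2 h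
  · intro a
    ext ⟨q, p⟩
    change _ ↔ (p, q) ∈ ρ a ∧ ∀ s, (s, q) ∈ ρ a → s = p
    have retract : ∀ {s}, c q (op a) ≠ c q z → (s, q) ∈ ρ a →
        ∀ h, c s h = c q (star (op a) h) := by
      intro s hne hs h
      obtain ⟨x, hx⟩ := point s
      obtain ⟨y, hxy, hy⟩ := point_of_mem hx hs
      obtain ⟨w, hw⟩ := (ne_z hy _).1 hne
      obtain rfl := (mop.1 hw).2 x hxy
      have hid : agreeAt θ x (star a (op a)) e :=
        agreeAt_of_mem hfun (mstar.2 ⟨y, hxy, hw⟩) (me.2 rfl)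
      rw [hs.2, ← assoc, (hx _ _).2 (agree_star hid h), e_star]
    constructor
    · rintro ⟨hne, hp⟩
      change ∀ h, c p h = c q (star (op a) h) at hp
      refine ⟨?_, fun s hs => hc (funext fun h => (retract hne hs h).trans (hp h).symm)⟩
      obtain ⟨y, hy⟩ := point q
      obtain ⟨x, hyx⟩ := (ne_z hy _).1 hne
      have hxy := (mop.1 hyx).1
      have hid : agreeAt θ y (star (op a) a) e :=
        agreeAt_of_mem hfun (mstar.2 ⟨x, hyx, hxy⟩) (me.2 rfl)
      refine ⟨(ne_z (image_point hy hyx hp) a).2 ⟨y, hxy⟩, fun h => ?_⟩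
      rw [hp, ← assoc, (hy _ _).2 (agree_star hid h), e_star]
    · rintro ⟨hpq, huniq⟩
      obtain ⟨x, hx⟩ := point p
      obtain ⟨y, hxy, hy⟩ := point_of_mem hx hpq
      suffices hne : c q (op a) ≠ c q z from ⟨hne, retract hne hpq⟩
      refine (ne_z hy _).2 ⟨x, mop.2 ⟨hxy, fun x' hx'y => ?_⟩⟩
      obtain ⟨s, hs, hsq⟩ := exists_preimage hy hx'y
      obtain rfl := huniq s ⟨(ne_z hs a).2 ⟨y, hx'y⟩, hsq⟩
      by_cases hret : ∃ h, agreeAt θ x (star a h) e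
      · obtain ⟨h, hh⟩ := hret
        have hh' : agreeAt θ x' (star a h) e := (hs _ _).1 ((hx _ _).2 hh)
        obtain ⟨w, hw, hwx⟩ := mstar.1 ((hh x).2 (me.2 rfl))
        obtain ⟨w', hw', hwx'⟩ := mstar.1 ((hh' x').2 (me.2 rfl))
        obtain rfl := hfun a _ _ _ hxy hw
        obtain rfl := hfun a _ _ _ hx'y hw'
        exact hfun h _ _ _ hwx' hwx
      · exfalso
        obtain ⟨n, hn⟩ : ∃ n, ∀ h, c s h ≠ n := by
          by_contra! hsurj
          exact hcard.not_ge (Fintype.card_le_of_surjective (c s) hsurj)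
        obtain ⟨t, ht⟩ := (hrange fun h => if agreeAt θ x h e then n else c s h).2 ⟨x, by
          intro h h'
          by_cases h₁ : agreeAt θ x h e <;> by_cases h₂ : agreeAt θ x h' e
          · simpa only [h₁, h₂, if_true, true_iff] using (agreeAt θ x).trans' h₁ ((agreeAt θ x).symm' h₂)
          · simp only [h₁, h₂, if_true, if_false, (hn h').symm, false_iff]
            exact fun h₃ => h₂ ((agreeAt θ x).trans' ((agreeAt θ x).symm' h₃) h₁)
          · simp only [h₁, h₂, if_true, if_false, hn h, false_iff]
            exact fun h₃ => h₁ ((agreeAt θ x).trans' h₃ h₂)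
          · simp only [h₁, h₂, if_false, hx]⟩
        have ht_off : ∀ h, ¬agreeAt θ x h e → c t h = c s h := fun h hh => by
          rw [ht]; exact if_neg hh
        have ht_e : c t e = n := by
          rw [ht]; exact if_pos ((agreeAt θ x).refl e)
        have ht_star : ∀ h, c t (star a h) = c s (star a h) := fun h =>
          ht_off _ fun hh => hret ⟨h, hh⟩
        have hts : t = s := by
          refine huniq t ⟨?_, fun h => (hpq.2 h).trans (ht_star h).symm⟩
          have ha := ht_star e
          have hz := ht_star z
          rw [star_e] at ha
          rw [star_z] at hz
          rw [ha, hz]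
          exact hpq.1
        exact hn e (hts ▸ ht_e)
  · ext ⟨p, q⟩
    exact ⟨fun h => h.1 rfl, False.elim⟩
  · ext ⟨p, q⟩
    exact mem_e

/-- The finite representation property for the full signature, including opposite. -/
theorem frp_full {A : Type*} [Fintype A]
    (star meet pref : A → A → A) (d r ad fix mi op : A → A) (z e : A)
    (h : ∃ (X : Type u) (θ : A → Set (X × X)),
      IsRepFull star meet pref d r ad fix mi op z e θ) :
    ∃ (Y : Type v) (_ : Fintype Y) (θ : A → Set (Y × Y)),
      IsRepFull star meet pref d r ad fix mi op z e θ := by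
  classical
  obtain ⟨X, θ, hθ⟩ := h
  let N := Fin (Fintype.card A + 1)
  let L := {f : A → N // ∃ x, ∀ h h', f h = f h' ↔ agreeAt θ x h h'}
  let φ : ULift.{v} (Fin (Fintype.card L)) ≃ L := Equiv.ulift.trans (Fintype.equivFin L).symm
  refine ⟨ULift.{v} (Fin (Fintype.card L)), inferInstance, _,
    hθ.labellingRep (N := N) (by simp [N]) (fun p => (φ p).1)
      (Subtype.val_injective.comp φ.injective) fun f => ⟨?_, fun hf => ?_⟩⟩
  · rintro ⟨p, rfl⟩
    exact (φ p).2
  · exact ⟨φ.symm ⟨f, hf⟩, by simp⟩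
end

section
/- Let A be a finite type equipped with binary operations ⋆ and ⊓ and unary operations d, r, op. If there exist a type X and a representation of (A, ⋆, ⊓, d, r, op) by partial functions on X, then there exist a finite type Y and such a representation on Y. (The finite representation property for the signature {composition, intersection, domain, range, opposite}.) -/
universe u v w

/-- Representation for the signature {composition, intersection, domain, range, opposite}. -/
def IsRepDRO {A : Type*} {X : Type u} (star meet : A → A → A) (d r op : A → A)
    (θ : A → Set (X × X)) : Prop :=
  Function.Injective θ ∧ (∀ a, Functional (θ a)) ∧
  (∀ a b, θ (star a b) = pComp (θ a) (θ b)) ∧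
  (∀ a b, θ (meet a b) = θ a ∩ θ b) ∧
  (∀ a, θ (d a) = pDom (θ a)) ∧
  (∀ a, θ (r a) = pRan (θ a)) ∧
  (∀ a, θ (op a) = pOpp (θ a))

namespace IsRepDRO

/-- The future of `x`, seen from `x`, with every vertex `z` of it named by its colour `c z`. -/
def profile {A : Type*} {X : Type*} {C : Type*} (θ : A → Set (X × X)) (c : X → C) (x : X) :
    Set (A × C) :=
  {p | ∃ z, (x, z) ∈ θ p.1 ∧ c z = p.2}

/-- The partial functions induced by `θ` on (codes of) profiles whose colouring is injective on
the future of the base vertex. -/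
def colouredRep {A : Type*} {X : Type*} {C : Type*} {Y : Type*} (θ : A → Set (X × X))
    (e : Set (A × C) → Y) (a : A) : Set (Y × Y) :=
  {p | ∃ x y, ∃ c : X → C, (x, y) ∈ θ a ∧ Set.InjOn c (future θ x) ∧
    e (profile θ c x) = p.1 ∧ e (profile θ c y) = p.2}

section Colouring

variable {X C : Type*}

theorem exists_forall_mem_ne {S : Set X} (hS : S.Finite) (hcard : S.ncard < Nat.card C)
    (c : X → C) : ∃ k, ∀ z ∈ S, c z ≠ k := by
  have : Finite C := Nat.finite_of_card_ne_zero (by omega)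
  by_contra! h
  have huniv : c '' S = Set.univ := Set.eq_univ_of_forall h
  have := Set.ncard_image_le (f := c) hS
  rw [huniv, Set.ncard_univ] at this
  omega

theorem injOn_update_insert [DecidableEq X] {S : Set X} {c : X → C} (hc : Set.InjOn c S) {x : X}
    {k : C} (hk : ∀ z ∈ S, c z ≠ k) : Set.InjOn (Function.update c x k) (insert x S) := by
  intro y hy z hz h
  by_cases hyx : y = x <;> by_cases hzx : z = x
  · rw [hyx, hzx]
  · rw [hyx, Function.update_self, Function.update_of_ne hzx] at h
    exact absurd h.symm (hk z (hz.resolve_left hzx))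
  · rw [hzx, Function.update_self, Function.update_of_ne hyx] at h
    exact absurd h (hk y (hy.resolve_left hyx))
  · rw [Function.update_of_ne hyx, Function.update_of_ne hzx] at h
    exact hc (hy.resolve_left hyx) (hz.resolve_left hzx) h

theorem exists_injOn_extend {S T : Set X} (hST : S ⊆ T) (hT : T.Finite)
    (hcard : T.ncard < Nat.card C) {c : X → C} (hc : Set.InjOn c S) :
    ∃ c' : X → C, Set.EqOn c' c S ∧ Set.InjOn c' T := by
  classical
  suffices H : ∀ U : Set X, U.Finite → U ⊆ T →
      ∃ c' : X → C, Set.EqOn c' c S ∧ Set.InjOn c' (U ∪ S) by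
    obtain ⟨c', h₁, h₂⟩ := H T hT subset_rfl
    exact ⟨c', h₁, h₂.mono Set.subset_union_left⟩
  intro U hU
  induction U, hU using Set.Finite.induction_on with
  | empty => exact fun _ => ⟨c, Set.eqOn_refl c S, by simpa using hc⟩
  | @insert x U _ _ ih =>
    intro hUT
    obtain ⟨c', h₁, h₂⟩ := ih ((Set.subset_insert x U).trans hUT)
    by_cases hx : x ∈ U ∪ S
    · exact ⟨c', h₁, by rwa [Set.insert_union, Set.insert_eq_of_mem hx]⟩
    · have hsub : U ∪ S ⊆ T := Set.union_subset ((Set.subset_insert x U).trans hUT) hST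
      obtain ⟨k, hk⟩ := exists_forall_mem_ne (hT.subset hsub)
        ((Set.ncard_le_ncard hsub hT).trans_lt hcard) c'
      refine ⟨Function.update c' x k, fun z hz => ?_, ?_⟩
      · rw [Function.update_of_ne (ne_of_mem_of_not_mem (Set.mem_union_right U hz) hx), h₁ hz]
      · rw [Set.insert_union]
        exact injOn_update_insert h₂ hk

end Colouring

section Future

variable {A X : Type*} {θ : A → Set (X × X)}

theorem mem_future {a : A} {x y : X} (h : (x, y) ∈ θ a) : y ∈ future θ x := ⟨a, h⟩

theorem finite_future [Finite A] (hfun : ∀ a, Functional (θ a)) (x : X) :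
    (future θ x).Finite ∧ (future θ x).ncard ≤ Nat.card A := by
  have hinj : Function.Injective fun y : future θ x => y.2.choose := by
    intro y z h
    have hy := y.2.choose_spec
    rw [show y.2.choose = z.2.choose from h] at hy
    exact Subtype.ext (hfun _ _ _ _ hy z.2.choose_spec)
  exact ⟨Set.finite_coe_iff.mp (Finite.of_injective _ hinj),
    Nat.card_le_card_of_injective _ hinj⟩

theorem profile_congr {C : Type*} {c c' : X → C} {x : X} (h : Set.EqOn c c' (future θ x)) :
    profile θ c x = profile θ c' x := by
  ext p
  refine exists_congr fun z => and_congr_right fun hz => ?_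
  rw [h (mem_future hz)]

end Future

variable {A X : Type*} {star meet : A → A → A} {d r op : A → A} {θ : A → Set (X × X)}

section Edges

theorem mem_star (h : IsRepDRO star meet d r op θ) {a b : A} {x z : X} :
    (x, z) ∈ θ (star a b) ↔ ∃ y, (x, y) ∈ θ a ∧ (y, z) ∈ θ b := by
  rw [h.2.2.1]; rfl

theorem mem_meet (h : IsRepDRO star meet d r op θ) {a b : A} {x y : X} :
    (x, y) ∈ θ (meet a b) ↔ (x, y) ∈ θ a ∧ (x, y) ∈ θ b := by
  rw [h.2.2.2.1]; rfl

theorem mem_d (h : IsRepDRO star meet d r op θ) {a : A} {x y : X} :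
    (x, y) ∈ θ (d a) ↔ x = y ∧ ∃ z, (x, z) ∈ θ a := by
  rw [h.2.2.2.2.1]; rfl

theorem mem_r (h : IsRepDRO star meet d r op θ) {a : A} {x y : X} :
    (x, y) ∈ θ (r a) ↔ x = y ∧ ∃ z, (z, y) ∈ θ a := by
  rw [h.2.2.2.2.2.1]; rfl

theorem mem_op (h : IsRepDRO star meet d r op θ) {a : A} {x y : X} :
    (y, x) ∈ θ (op a) ↔ (x, y) ∈ θ a ∧ ∀ x', (x', y) ∈ θ a → x' = x := by
  rw [h.2.2.2.2.2.2]; rfl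

theorem self_mem_future_left (h : IsRepDRO star meet d r op θ) {a : A} {x y : X}
    (hxy : (x, y) ∈ θ a) : x ∈ future θ x :=
  ⟨d a, h.mem_d.2 ⟨rfl, y, hxy⟩⟩

theorem self_mem_future_right (h : IsRepDRO star meet d r op θ) {a : A} {x y : X}
    (hxy : (x, y) ∈ θ a) : y ∈ future θ y :=
  ⟨r a, h.mem_r.2 ⟨rfl, x, hxy⟩⟩

theorem future_subset (h : IsRepDRO star meet d r op θ) {x y : X}
    (hxy : y ∈ future θ x) : future θ y ⊆ future θ x := by
  obtain ⟨a, ha⟩ := hxy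
  rintro z ⟨b, hb⟩
  exact ⟨star a b, h.mem_star.2 ⟨y, ha, hb⟩⟩

variable {C : Type*} {c c' : X → C} {x x' y : X}

theorem colour_eq_of_profile_eq (h : IsRepDRO star meet d r op θ) (hx : x ∈ future θ x)
    (hp : profile θ c x = profile θ c' x') : c x = c' x' := by
  obtain ⟨a, ha⟩ := hx
  have hmem : (d a, c x) ∈ profile θ c x := ⟨x, h.mem_d.2 ⟨rfl, x, ha⟩, rfl⟩
  rw [hp] at hmem
  obtain ⟨z, hz, hcz⟩ := hmem
  rw [(h.mem_d.1 hz).1]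
  exact hcz.symm

theorem profile_eq_of_mem (h : IsRepDRO star meet d r op θ) {a : A} (hxy : (x, y) ∈ θ a) :
    profile θ c y = {p | (star a p.1, p.2) ∈ profile θ c x} := by
  ext ⟨b, k⟩
  refine exists_congr fun z => and_congr_left fun _ => ?_
  rw [h.mem_star]
  refine ⟨fun hz => ⟨y, hxy, hz⟩, ?_⟩
  rintro ⟨y', hy', hz⟩
  rwa [h.2.1 a x y y' hxy hy']

theorem exists_step_of_profile_eq (h : IsRepDRO star meet d r op θ) {a : A}
    (hxy : (x, y) ∈ θ a) (hp : profile θ c x = profile θ c' x') :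
    ∃ y', (x', y') ∈ θ a ∧ profile θ c y = profile θ c' y' := by
  have hmem : (a, c y) ∈ profile θ c x := ⟨y, hxy, rfl⟩
  rw [hp] at hmem
  obtain ⟨y', hy', -⟩ := hmem
  exact ⟨y', hy', by rw [h.profile_eq_of_mem hxy, h.profile_eq_of_mem hy', hp]⟩

end Edges

section ColouredRep

variable {C Y : Type*} {e : Set (A × C) → Y} {c : X → C} {x y : X}

theorem mem_colouredRep_of_mem {a : A} (hxy : (x, y) ∈ θ a)
    (hc : Set.InjOn c (future θ x)) :
    (e (profile θ c x), e (profile θ c y)) ∈ colouredRep θ e a :=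
  ⟨x, y, c, hxy, hc, rfl, rfl⟩

theorem mem_colouredRep_iff (h : IsRepDRO star meet d r op θ) (he : Function.Injective e) {a : A}
    {q : Y} (hc : Set.InjOn c (future θ x)) :
    (e (profile θ c x), q) ∈ colouredRep θ e a ↔ ∃ y, (x, y) ∈ θ a ∧ e (profile θ c y) = q := by
  constructor
  · rintro ⟨x', y', c', hxy', -, hx, hy⟩
    obtain ⟨y, hxy, hp⟩ := h.exists_step_of_profile_eq hxy' (he hx)
    exact ⟨y, hxy, hp ▸ hy⟩
  · rintro ⟨y, hxy, rfl⟩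
    exact mem_colouredRep_of_mem hxy hc

theorem eq_of_profile_eq (h : IsRepDRO star meet d r op θ) (hc : Set.InjOn c (future θ x))
    {y z : X} (hy : y ∈ future θ x) (hz : z ∈ future θ x)
    (hp : profile θ c y = profile θ c z) : y = z := by
  obtain ⟨a, ha⟩ := hy
  exact hc ⟨a, ha⟩ hz (h.colour_eq_of_profile_eq (h.self_mem_future_right ha) hp)

/-- An edge ending in `y` is a coloured edge ending in any coloured version of `y`. -/
theorem exists_extend_colouring [Finite A] (h : IsRepDRO star meet d r op θ)
    (hcard : Nat.card A < Nat.card C) {a : A} (hxy : (x, y) ∈ θ a)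
    (hc : Set.InjOn c (future θ y)) :
    ∃ c' : X → C, Set.EqOn c' c (future θ y) ∧ Set.InjOn c' (future θ x) ∧
      profile θ c' y = profile θ c y := by
  have hfin := finite_future h.2.1 x
  obtain ⟨c', h₁, h₂⟩ := exists_injOn_extend (h.future_subset (mem_future hxy)) hfin.1
    (hfin.2.trans_lt hcard) hc
  exact ⟨c', h₁, h₂, profile_congr h₁⟩

theorem subset_of_colouredRep_subset [Finite A] (h : IsRepDRO star meet d r op θ)
    (he : Function.Injective e) (hcard : Nat.card A < Nat.card C) {a b : A}
    (hab : colouredRep θ e a ⊆ colouredRep θ e b) : θ a ⊆ θ b := by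
  rintro ⟨x, y⟩ hxy
  have : Nonempty C := (Nat.card_pos_iff.1 (by omega)).1
  have hfin := finite_future h.2.1 x
  obtain ⟨c, -, hc⟩ := exists_injOn_extend (Set.empty_subset _) hfin.1
    (hfin.2.trans_lt hcard) (c := fun _ => Classical.arbitrary C) (Set.injOn_empty _)
  obtain ⟨y', hxy', hp⟩ := (h.mem_colouredRep_iff he hc).1 (hab (mem_colouredRep_of_mem hxy hc))
  rwa [h.eq_of_profile_eq hc (mem_future hxy) (mem_future hxy') (he hp.symm)]

theorem colouredRep_functional (h : IsRepDRO star meet d r op θ) (he : Function.Injective e)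
    (a : A) : Functional (colouredRep θ e a) := by
  rintro _ _ q' ⟨x, y, c, hxy, hc, rfl, rfl⟩ hq'
  obtain ⟨y', hxy', rfl⟩ := (h.mem_colouredRep_iff he hc).1 hq'
  rw [h.2.1 a x y y' hxy hxy']

theorem colouredRep_star (h : IsRepDRO star meet d r op θ) (he : Function.Injective e) (a b : A) :
    colouredRep θ e (star a b) = pComp (colouredRep θ e a) (colouredRep θ e b) := by
  ext ⟨p, q⟩
  constructor
  · rintro ⟨x, z, c, hxz, hc, rfl, rfl⟩
    obtain ⟨y, hxy, hyz⟩ := h.mem_star.1 hxz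
    exact ⟨_, mem_colouredRep_of_mem hxy hc,
      mem_colouredRep_of_mem hyz (hc.mono (h.future_subset (mem_future hxy)))⟩
  · rintro ⟨_, ⟨x, y, c, hxy, hc, rfl, rfl⟩, hq⟩
    obtain ⟨z, hyz, rfl⟩ :=
      (h.mem_colouredRep_iff he (hc.mono (h.future_subset (mem_future hxy)))).1 hq
    exact mem_colouredRep_of_mem (h.mem_star.2 ⟨y, hxy, hyz⟩) hc

theorem colouredRep_meet (h : IsRepDRO star meet d r op θ) (he : Function.Injective e) (a b : A) :
    colouredRep θ e (meet a b) = colouredRep θ e a ∩ colouredRep θ e b := by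
  ext ⟨p, q⟩
  constructor
  · rintro ⟨x, y, c, hxy, hc, rfl, rfl⟩
    exact ⟨mem_colouredRep_of_mem (h.mem_meet.1 hxy).1 hc,
      mem_colouredRep_of_mem (h.mem_meet.1 hxy).2 hc⟩
  · rintro ⟨⟨x, y, c, hxy, hc, rfl, rfl⟩, hb⟩
    obtain ⟨y', hxy', hp⟩ := (h.mem_colouredRep_iff he hc).1 hb
    obtain rfl := h.eq_of_profile_eq hc (mem_future hxy') (mem_future hxy) (he hp)
    exact mem_colouredRep_of_mem (h.mem_meet.2 ⟨hxy, hxy'⟩) hc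

theorem colouredRep_d (h : IsRepDRO star meet d r op θ) (a : A) :
    colouredRep θ e (d a) = pDom (colouredRep θ e a) := by
  ext ⟨p, q⟩
  constructor
  · rintro ⟨x, y, c, hxy, hc, rfl, rfl⟩
    obtain ⟨rfl, z, hz⟩ := h.mem_d.1 hxy
    exact ⟨rfl, _, mem_colouredRep_of_mem hz hc⟩
  · rintro ⟨hpq, _, x, y, c, hxy, hc, rfl, rfl⟩
    obtain rfl : e (profile θ c x) = q := hpq
    exact mem_colouredRep_of_mem (h.mem_d.2 ⟨rfl, y, hxy⟩) hc

theorem colouredRep_r [Finite A] (h : IsRepDRO star meet d r op θ)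
    (hcard : Nat.card A < Nat.card C) (a : A) :
    colouredRep θ e (r a) = pRan (colouredRep θ e a) := by
  ext ⟨p, q⟩
  constructor
  · rintro ⟨x, y, c, hxy, hc, rfl, rfl⟩
    obtain ⟨rfl, z, hz⟩ := h.mem_r.1 hxy
    obtain ⟨c', -, hc', hp⟩ := h.exists_extend_colouring hcard hz hc
    exact ⟨rfl, _, hp ▸ mem_colouredRep_of_mem hz hc'⟩
  · rintro ⟨hpq, _, x, y, c, hxy, hc, rfl, rfl⟩
    obtain rfl : p = e (profile θ c y) := hpq
    exact mem_colouredRep_of_mem (h.mem_r.2 ⟨rfl, x, hxy⟩)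
      (hc.mono (h.future_subset (mem_future hxy)))

/-- If `(x, y)` is the only edge with label `a` ending in some coloured version of `y`, then
it is the only such edge ending in `y`. -/
theorem eq_of_colouredRep_unique [Finite A] (h : IsRepDRO star meet d r op θ)
    (he : Function.Injective e) (hcard : Nat.card A < Nat.card C) {a : A} (hxy : (x, y) ∈ θ a)
    (hc : Set.InjOn c (future θ x))
    (huniq : ∀ p, (p, e (profile θ c y)) ∈ colouredRep θ e a → p = e (profile θ c x))
    {x' : X} (hxy' : (x', y) ∈ θ a) : x' = x := by
  classical
  have hsub := h.future_subset (mem_future hxy)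
  have hself := h.self_mem_future_left hxy
  by_cases hx : x ∈ future θ y
  · obtain ⟨c', hcc', hc', hp⟩ := h.exists_extend_colouring hcard hxy' (hc.mono hsub)
    have hp' := he (huniq _ (hp ▸ mem_colouredRep_of_mem hxy' hc'))
    have hself' := h.self_mem_future_left hxy'
    refine hc' hself' (h.future_subset (mem_future hxy') hx) ?_
    rw [h.colour_eq_of_profile_eq hself' hp', hcc' hx]
  · exfalso
    have hfin := finite_future h.2.1 x
    obtain ⟨k, hk⟩ := exists_forall_mem_ne hfin.1 (hfin.2.trans_lt hcard) c
    have hc' : Set.InjOn (Function.update c x k) (future θ x) :=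
      (injOn_update_insert hc hk).mono (Set.subset_insert _ _)
    have hp : profile θ (Function.update c x k) y = profile θ c y :=
      profile_congr fun z hz => Function.update_of_ne (ne_of_mem_of_not_mem hz hx) _ _
    have hp' := he (huniq _ (hp ▸ mem_colouredRep_of_mem hxy hc'))
    have hcol := h.colour_eq_of_profile_eq hself hp'
    rw [Function.update_self] at hcol
    exact hk x hself hcol.symm

theorem colouredRep_op [Finite A] (h : IsRepDRO star meet d r op θ)
    (he : Function.Injective e) (hcard : Nat.card A < Nat.card C) (a : A) :
    colouredRep θ e (op a) = pOpp (colouredRep θ e a) := by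
  ext ⟨q, p⟩
  constructor
  · rintro ⟨y, x, c, hyx, hc, rfl, rfl⟩
    refine ⟨mem_colouredRep_of_mem (h.mem_op.1 hyx).1
      (hc.mono (h.future_subset (mem_future hyx))), ?_⟩
    rintro _ ⟨x', y', c', hxy', -, rfl, hy⟩
    obtain ⟨w, hyw, hp⟩ := h.exists_step_of_profile_eq hyx (he hy).symm
    rw [(h.mem_op.1 hyw).2 x' hxy', hp]
  · rintro ⟨⟨x, y, c, hxy, hc, rfl, rfl⟩, huniq⟩
    exact mem_colouredRep_of_mem
      (h.mem_op.2 ⟨hxy, fun _ => h.eq_of_colouredRep_unique he hcard hxy hc huniq⟩)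
      (hc.mono (h.future_subset (mem_future hxy)))

theorem isRepDRO_colouredRep [Finite A] (h : IsRepDRO star meet d r op θ)
    (he : Function.Injective e) (hcard : Nat.card A < Nat.card C) :
    IsRepDRO star meet d r op (colouredRep θ e) :=
  ⟨fun _ _ hab => h.1 ((h.subset_of_colouredRep_subset he hcard hab.subset).antisymm
      (h.subset_of_colouredRep_subset he hcard hab.superset)),
    h.colouredRep_functional he, h.colouredRep_star he, h.colouredRep_meet he, h.colouredRep_d,
    h.colouredRep_r hcard, h.colouredRep_op he hcard⟩

end ColouredRep

end IsRepDRO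

/-- The finite representation property for the signature
{composition, intersection, domain, range, opposite}. -/
theorem frp_comp_meet_dom_ran_op {A : Type*} [Fintype A]
    (star meet : A → A → A) (d r op : A → A)
    (h : ∃ (X : Type u) (θ : A → Set (X × X)), IsRepDRO star meet d r op θ) :
    ∃ (Y : Type v) (_ : Fintype Y) (θ : A → Set (Y × Y)), IsRepDRO star meet d r op θ := by
  obtain ⟨X, θ, hθ⟩ := h
  let e := Finite.equivFin (Set (A × Fin (Nat.card A + 1)))
  exact ⟨ULift.{v} (Fin (Nat.card (Set (A × Fin (Nat.card A + 1))))), inferInstance, _,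
    hθ.isRepDRO_colouredRep (ULift.up_injective.comp e.injective) (by simp)⟩
end

section
/- There is a constant c ∈ ℕ such that the following holds: for every finite type A equipped with binary operations ⋆, ⊓, ⊔, unary operations d, r, ad, fix, mi, op and constants z, e, if A has a representation by partial functions on some type (for the signature {composition, intersection, domain, range, zero, identity, antidomain, fixset, preferential union, maximum iterate, opposite}), then A has such a representation on a finite type Y with |Y| ≤ |A| ^ (|A| ^ (c · (⌊√|A|⌋ + 1))). (A double-exponential bound on the size of base required.) -/
universe u v w

/-- `k` colours the elements of `A` so that the elements defined at `x` are exactly the coloured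
ones, and two of them have the same colour exactly when they send `x` to the same point. -/
def ColoursFuture {A ι : Type*} {X : Type v} (θ : A → Set (X × X)) (x : X)
    (k : A → Option ι) : Prop :=
  ∀ a b, (∃ i, k a = some i ∧ k b = some i) ↔ ∃ y, (x, y) ∈ θ a ∧ (x, y) ∈ θ b

/-- The action of `A` on a family `K` of colourings of `A` by translation. -/
def colouringRep {A ι : Type*} {Y : Type w} (star : A → A → A) (K : Y → A → Option ι)
    (a : A) : Set (Y × Y) :=
  {p | (∃ i, K p.1 a = some i) ∧ ∀ b, K p.2 b = K p.1 (star a b)}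

/-- An injective colouring of a finite set extends to any larger set having at most as many
elements as there are colours. -/
theorem exists_injOn_extension {X ι : Type*} [Fintype ι] (S : Set X) (hS : S.Finite)
    (j : X → ι) (hj : Set.InjOn j S) (T : Set X) (hT : T.Finite) (hST : S ⊆ T)
    (hcard : T.ncard ≤ Fintype.card ι) :
    ∃ j' : X → ι, Set.InjOn j' T ∧ Set.EqOn j' j S := by
  classical
  suffices h : ∀ U : Set X, U.Finite → (S ∪ U).ncard ≤ Fintype.card ι →
      ∃ j' : X → ι, Set.InjOn j' (S ∪ U) ∧ Set.EqOn j' j S by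
    simpa only [Set.union_eq_self_of_subset_left hST, hcard, true_implies] using h T hT
  intro U hU
  induction U, hU using Set.Finite.induction_on with
  | empty => exact fun _ => ⟨j, by simpa using hj, fun _ _ => rfl⟩
  | @insert x U _ hU ih =>
    intro hle
    have hfin : (S ∪ U).Finite := hS.union hU
    rw [Set.union_insert] at hle ⊢
    obtain ⟨j', hj', heq⟩ := ih <|
      (Set.ncard_le_ncard (Set.subset_insert _ _) (hfin.insert x)).trans hle
    by_cases hx : x ∈ S ∪ U
    · exact ⟨j', by rwa [Set.insert_eq_of_mem hx], heq⟩
    · rw [Set.ncard_insert_of_notMem hx hfin, Set.ncard_eq_toFinset_card _ hfin] at hle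
      obtain ⟨i, hi⟩ : ∃ i, i ∉ hfin.toFinset.image j' := by
        by_contra! hall
        have h₁ := Finset.card_image_le (s := hfin.toFinset) (f := j')
        rw [Finset.eq_univ_iff_forall.2 hall, Finset.card_univ] at h₁
        omega
      have hupd : Set.EqOn (Function.update j' x i) j' (S ∪ U) := fun z hz =>
        Function.update_of_ne (fun h : z = x => hx (h ▸ hz)) _ _
      refine ⟨Function.update j' x i, (Set.injOn_insert hx).2 ⟨hupd.injOn_iff.2 hj', ?_⟩,
        (hupd.mono Set.subset_union_left).trans heq⟩
      rw [hupd.image_eq, Function.update_self]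
      simpa using hi

namespace ColoursFuture

variable {A ι : Type*} {X : Type v} {θ : A → Set (X × X)} {x y : X} {k : A → Option ι}

theorem defined_iff (hk : ColoursFuture θ x k) (a : A) :
    (∃ i, k a = some i) ↔ ∃ y, (x, y) ∈ θ a := by
  simpa using hk a a

theorem eq_of_mem (hk : ColoursFuture θ x k) {a b : A} (ha : (x, y) ∈ θ a)
    (hb : (x, y) ∈ θ b) : k a = k b := by
  obtain ⟨i, h₁, h₂⟩ := (hk a b).2 ⟨y, ha, hb⟩
  rw [h₁, h₂]

theorem mem_of_eq (hk : ColoursFuture θ x k) (hfun : ∀ a, Functional (θ a)) {a b : A}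
    (ha : (x, y) ∈ θ a) (hab : k a = k b) : (x, y) ∈ θ b := by
  obtain ⟨i, hi⟩ := (hk.defined_iff a).2 ⟨y, ha⟩
  obtain ⟨y', h₁, h₂⟩ := (hk a b).1 ⟨i, hi, hab ▸ hi⟩
  rwa [hfun a x y y' ha h₁]

theorem eq_of_iff (hk : ColoursFuture θ x k) {a b : A}
    (h : ∀ y, (x, y) ∈ θ a ↔ (x, y) ∈ θ b) : k a = k b := by
  by_cases hd : ∃ y, (x, y) ∈ θ a
  · obtain ⟨y, hy⟩ := hd
    exact hk.eq_of_mem hy ((h y).1 hy)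
  · have h₁ := mt (hk.defined_iff a).1 hd
    have h₂ := mt (hk.defined_iff b).1 (by simpa only [h] using hd)
    rw [← Option.isSome_iff_exists, Option.not_isSome_iff_eq_none] at h₁ h₂
    rw [h₁, h₂]

theorem translate (hk : ColoursFuture θ x k) (hfun : ∀ a, Functional (θ a))
    {star : A → A → A} (hstar : ∀ a b, θ (star a b) = pComp (θ a) (θ b)) {a : A}
    (ha : (x, y) ∈ θ a) : ColoursFuture θ y (fun b => k (star a b)) := by
  have key : ∀ b z, (x, z) ∈ θ (star a b) ↔ (y, z) ∈ θ b := fun b z => by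
    rw [hstar]
    refine ⟨?_, fun h => ⟨y, ha, h⟩⟩
    rintro ⟨y', h₁, h₂⟩
    rwa [hfun a x y y' ha h₁]
  intro b c
  simpa only [key] using hk (star a b) (star a c)

/-- An injective colouring of the future of `x` induces a colouring of `A`. -/
theorem exists_of_injOn (hfun : ∀ a, Functional (θ a)) (x : X) (j : X → ι)
    (hj : Set.InjOn j (future θ x)) :
    ∃ k, ColoursFuture θ x k ∧ ∀ a y, (x, y) ∈ θ a → k a = some (j y) := by
  classical
  have hval : ∀ a, ∃ o : Option ι, (∀ y, (x, y) ∈ θ a → o = some (j y)) ∧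
      ((¬∃ y, (x, y) ∈ θ a) → o = none) := fun a => by
    by_cases h : ∃ y, (x, y) ∈ θ a
    · obtain ⟨y, hy⟩ := h
      exact ⟨some (j y), fun y' hy' => by rw [hfun a x y y' hy hy'], fun h => (h ⟨y, hy⟩).elim⟩
    · exact ⟨none, fun y hy => (h ⟨y, hy⟩).elim, fun _ => rfl⟩
  choose k hk₁ hk₂ using hval
  refine ⟨k, fun a b => ⟨?_, ?_⟩, hk₁⟩
  · rintro ⟨i, ha, hb⟩
    have hda : ∃ y, (x, y) ∈ θ a := by
      by_contra h
      simp [hk₂ a h] at ha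
    have hdb : ∃ y, (x, y) ∈ θ b := by
      by_contra h
      simp [hk₂ b h] at hb
    obtain ⟨y, hy⟩ := hda
    obtain ⟨y', hy'⟩ := hdb
    have hjj : j y = j y' := by
      have h₁ := hk₁ a y hy
      have h₂ := hk₁ b y' hy'
      rw [ha] at h₁
      rw [hb, h₁] at h₂
      simpa using h₂
    have hyy := hj ⟨a, hy⟩ ⟨b, hy'⟩ hjj
    exact ⟨y, hy, hyy ▸ hy'⟩
  · rintro ⟨y, ha, hb⟩
    exact ⟨j y, hk₁ a y ha, hk₁ b y hb⟩

/-- A colouring of `A` at `y` is induced by an injective colouring of the future of `y`. -/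
theorem exists_injOn [Nonempty ι] (hk : ColoursFuture θ y k) (hfun : ∀ a, Functional (θ a)) :
    ∃ j : X → ι, Set.InjOn j (future θ y) ∧ ∀ a z, (y, z) ∈ θ a → k a = some (j z) := by
  classical
  have hval : ∀ z, ∃ i, ∀ a, (y, z) ∈ θ a → k a = some i := fun z => by
    by_cases h : ∃ a, (y, z) ∈ θ a
    · obtain ⟨a, ha⟩ := h
      obtain ⟨i, hi⟩ := (hk.defined_iff a).2 ⟨z, ha⟩
      exact ⟨i, fun b hb => by rw [hk.eq_of_mem hb ha, hi]⟩
    · exact ⟨Classical.arbitrary ι, fun a ha => (h ⟨a, ha⟩).elim⟩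
  choose j hj using hval
  refine ⟨j, ?_, fun a z => hj z a⟩
  rintro z ⟨a, ha⟩ z' ⟨b, hb⟩ hzz
  have hab : k a = k b := by rw [hj z a ha, hj z' b hb, hzz]
  exact hfun b y z z' (hk.mem_of_eq hfun ha hab) hb

end ColoursFuture

theorem future_finite_and_ncard_le {A : Type*} [Fintype A] {X : Type v} {θ : A → Set (X × X)}
    (hfun : ∀ a, Functional (θ a)) (x : X) :
    (future θ x).Finite ∧ (future θ x).ncard ≤ Fintype.card A := by
  classical
  have hsub : future θ x ⊆
      Set.range (fun a : A => if h : ∃ y, (x, y) ∈ θ a then h.choose else x) := by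
    rintro y ⟨a, ha⟩
    have h : ∃ y, (x, y) ∈ θ a := ⟨y, ha⟩
    refine ⟨a, ?_⟩
    simp only [h, ↓reduceDIte]
    exact hfun a x _ _ h.choose_spec ha
  refine ⟨(Set.finite_range _).subset hsub, (Set.ncard_le_ncard hsub (Set.finite_range _)).trans ?_⟩
  rw [← Set.image_univ]
  refine (Set.ncard_image_le Set.finite_univ).trans ?_
  rw [Set.ncard_univ, Nat.card_eq_fintype_card]

/-- A colouring at `y` extends backwards along any edge `(x, y)`, and in at least two ways when `x`
is not in the future of `y`. -/
theorem ColoursFuture.exists_extension {A ι : Type*} [Fintype A] [Fintype ι] {X : Type v}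
    {θ : A → Set (X × X)} {star : A → A → A} {e : A}
    (hfun : ∀ a, Functional (θ a)) (hstar : ∀ a b, θ (star a b) = pComp (θ a) (θ b))
    (he : θ e = pId X) (hι : Fintype.card A < Fintype.card ι) {x y : X} {a : A}
    (ha : (x, y) ∈ θ a) {k : A → Option ι} (hk : ColoursFuture θ y k) :
    (∃ k', ColoursFuture θ x k' ∧ ∀ b, k b = k' (star a b)) ∧
    (x ∉ future θ y → ∃ k₁ k₂, k₁ ≠ k₂ ∧ (ColoursFuture θ x k₁ ∧ ∀ b, k b = k₁ (star a b)) ∧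
      (ColoursFuture θ x k₂ ∧ ∀ b, k b = k₂ (star a b))) := by
  classical
  have hne : Nonempty ι := Fintype.card_pos_iff.1 (by omega)
  obtain ⟨j, hj, hjk⟩ := hk.exists_injOn hfun
  obtain ⟨hyfin, hycard⟩ := future_finite_and_ncard_le hfun y
  obtain ⟨hxfin, hxcard⟩ := future_finite_and_ncard_le hfun x
  have hsub : future θ y ⊆ future θ x := by
    rintro z ⟨b, hb⟩
    exact ⟨star a b, by rw [hstar]; exact ⟨y, ha, hb⟩⟩
  have hxx : x ∈ future θ x := ⟨e, by rw [he]; rfl⟩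
  have main : ∀ S : Set X, future θ y ⊆ S → S ⊆ future θ x → ∀ j' : X → ι, Set.InjOn j' S →
      Set.EqOn j' j (future θ y) → ∃ k', (ColoursFuture θ x k' ∧ ∀ b, k b = k' (star a b)) ∧
        (x ∈ S → k' e = some (j' x)) := by
    intro S hyS hSx j' hj' hjj
    obtain ⟨j₂, hj₂, hjj₂⟩ := exists_injOn_extension S (hxfin.subset hSx) j' hj' _ hxfin hSx
      (by omega)
    obtain ⟨k', hk', hkj⟩ := ColoursFuture.exists_of_injOn hfun x j₂ hj₂
    refine ⟨k', ⟨hk', fun b => ?_⟩, fun hxS => ?_⟩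
    · have hk'' := hk'.translate hfun hstar ha
      by_cases hb : ∃ z, (y, z) ∈ θ b
      · obtain ⟨z, hz⟩ := hb
        have hzy : z ∈ future θ y := ⟨b, hz⟩
        rw [hjk b z hz, hkj (star a b) z (by rw [hstar]; exact ⟨y, ha, hz⟩), hjj₂ (hyS hzy),
          hjj hzy]
      · have h₁ := mt (hk.defined_iff b).1 hb
        have h₂ := mt (hk''.defined_iff b).1 hb
        rw [← Option.isSome_iff_exists, Option.not_isSome_iff_eq_none] at h₁ h₂
        rw [h₁, h₂]
    · rw [hkj e x (by rw [he]; rfl), hjj₂ hxS]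
  constructor
  · obtain ⟨k', hk', -⟩ := main _ subset_rfl hsub j hj (fun _ _ => rfl)
    exact ⟨k', hk'⟩
  · intro hxy
    have hlt : (future θ y).ncard < (future θ x).ncard :=
      Set.ncard_lt_ncard ⟨hsub, fun h => hxy (h hxx)⟩ hxfin
    have hcard : 1 < ((hyfin.toFinset.image j)ᶜ).card := by
      have h₁ := Finset.card_image_le (s := hyfin.toFinset) (f := j)
      rw [← Set.ncard_eq_toFinset_card _ hyfin] at h₁
      rw [Finset.card_compl]
      omega
    obtain ⟨i₁, hi₁, i₂, hi₂, hi⟩ := Finset.one_lt_card.1 hcard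
    have hupd : ∀ i ∈ (hyfin.toFinset.image j)ᶜ, ∃ k',
        (ColoursFuture θ x k' ∧ ∀ b, k b = k' (star a b)) ∧ k' e = some i := by
      intro i hi
      have heq : Set.EqOn (Function.update j x i) j (future θ y) := fun z hz =>
        Function.update_of_ne (fun h : z = x => hxy (h ▸ hz)) _ _
      obtain ⟨k', hk', hk'e⟩ := main (insert x (future θ y)) (Set.subset_insert _ _)
        (Set.insert_subset hxx hsub) (Function.update j x i)
        ((Set.injOn_insert hxy).2 ⟨heq.injOn_iff.2 hj, by
          rw [heq.image_eq, Function.update_self]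
          simpa using hi⟩) heq
      exact ⟨k', hk', by simpa using hk'e (Set.mem_insert _ _)⟩
    obtain ⟨k₁, hk₁, hk₁e⟩ := hupd i₁ hi₁
    obtain ⟨k₂, hk₂, hk₂e⟩ := hupd i₂ hi₂
    refine ⟨k₁, k₂, fun h => hi ?_, hk₁, hk₂⟩
    rw [h, hk₂e] at hk₁e
    exact (Option.some.inj hk₁e).symm

/-- An edge of the translation action on colourings has the same labels as some edge of the given
representation. -/
theorem colouringRep_transfer {A ι : Type*} {X : Type v} {Y : Type w} {θ : A → Set (X × X)}
    {star : A → A → A} {e : A} (hfun : ∀ a, Functional (θ a))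
    (hstar : ∀ a b, θ (star a b) = pComp (θ a) (θ b)) (hright : ∀ a, star a e = a)
    {K : Y → A → Option ι} {x y : X} {p q : Y} (hp : ColoursFuture θ x (K p)) {a : A}
    (hxy : (x, y) ∈ θ a) (hq : ∀ b, K q b = K p (star a b)) (b : A) :
    (p, q) ∈ colouringRep star K b ↔ (x, y) ∈ θ b := by
  constructor
  · rintro ⟨-, h⟩
    have hab : K p a = K p b := by
      have h₁ := hq e
      have h₂ := h e
      dsimp only at h₂
      rw [hright] at h₁ h₂
      rw [← h₁, h₂]
    exact hp.mem_of_eq hfun hxy hab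
  · intro hb
    refine ⟨(hp.defined_iff b).2 ⟨y, hb⟩, fun c => ?_⟩
    have hac : ∀ c a', (x, y) ∈ θ a' → ∀ z, (x, z) ∈ θ (star a' c) ↔ (y, z) ∈ θ c := by
      intro c a' ha' z
      rw [hstar]
      refine ⟨?_, fun h => ⟨y, ha', h⟩⟩
      rintro ⟨y', h₁, h₂⟩
      rwa [hfun a' x y y' ha' h₁]
    dsimp only
    rw [hq c]
    exact hp.eq_of_iff fun z => by rw [hac c a hxy, hac c b hb]

theorem isRepFull_colouringRep {A ι : Type*} [Fintype A] [Fintype ι] {X : Type v} {Y : Type w}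
    {star meet pref : A → A → A} {d r ad fix mi op : A → A} {z e : A} {θ : A → Set (X × X)}
    (hθ : IsRepFull star meet pref d r ad fix mi op z e θ)
    (hι : Fintype.card A < Fintype.card ι) {K : Y → A → Option ι} (hK : Function.Injective K)
    (hrange : ∀ k, (∃ p, K p = k) ↔ ∃ x, ColoursFuture θ x k) :
    IsRepFull star meet pref d r ad fix mi op z e (colouringRep star K) := by
  classical
  obtain ⟨hinj, hfun, hstar, hmeet, hpref, hd, hr, had, hfix, hmi, hop, hz, he⟩ := hθ
  have hright : ∀ a, star a e = a := fun a => hinj <| by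
    rw [hstar, he]
    ext ⟨x, y⟩
    simp [pComp, pId]
  have hleft : ∀ a, star e a = a := fun a => hinj <| by
    rw [hstar, he]
    ext ⟨x, y⟩
    simp [pComp, pId]
  have hassoc : ∀ a b c, star (star a b) c = star a (star b c) := fun a b c => hinj <| by
    simp only [hstar]
    ext ⟨x, y⟩
    constructor
    · rintro ⟨u, ⟨v, h₁, h₂⟩, h₃⟩
      exact ⟨v, h₁, u, h₂, h₃⟩
    · rintro ⟨v, h₁, u, h₂, h₃⟩
      exact ⟨u, ⟨v, h₁, h₂⟩, h₃⟩
  have hne : Nonempty ι := Fintype.card_pos_iff.1 (by omega)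
  have hpoint : ∀ p, ∃ x, ColoursFuture θ x (K p) := fun p => (hrange _).1 ⟨p, rfl⟩
  have hcol : ∀ x, ∃ p, ColoursFuture θ x (K p) := fun x => by
    obtain ⟨hxfin, hxcard⟩ := future_finite_and_ncard_le hfun x
    obtain ⟨j, hj, -⟩ := exists_injOn_extension ∅ Set.finite_empty
      (fun _ : X => Classical.arbitrary ι) (by simp) _ hxfin (by simp) (by omega)
    obtain ⟨k, hk, -⟩ := ColoursFuture.exists_of_injOn hfun x j hj
    obtain ⟨p, rfl⟩ := (hrange k).2 ⟨x, hk⟩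
    exact ⟨p, hk⟩
  have htrans : ∀ {x y p q a}, ColoursFuture θ x (K p) → (x, y) ∈ θ a →
      (p, q) ∈ colouringRep star K a →
      ColoursFuture θ y (K q) ∧ ∀ b, (p, q) ∈ colouringRep star K b ↔ (x, y) ∈ θ b := by
    intro x y p q a hp hxy hpq
    refine ⟨?_, colouringRep_transfer hfun hstar hright hp hxy hpq.2⟩
    have := hp.translate hfun hstar hxy
    rwa [← funext hpq.2] at this
  have hforth : ∀ {x y p a}, ColoursFuture θ x (K p) → (x, y) ∈ θ a →
      ∃ q, ColoursFuture θ y (K q) ∧ ∀ b, (p, q) ∈ colouringRep star K b ↔ (x, y) ∈ θ b := by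
    intro x y p a hp hxy
    have h := hp.translate hfun hstar hxy
    obtain ⟨q, hq⟩ := (hrange _).2 ⟨y, h⟩
    exact ⟨q, hq ▸ h, colouringRep_transfer hfun hstar hright hp hxy (congrFun hq)⟩
  have hback : ∀ {x p q a}, ColoursFuture θ x (K p) → (p, q) ∈ colouringRep star K a →
      ∃ y, (x, y) ∈ θ a ∧ ColoursFuture θ y (K q) ∧
        ∀ b, (p, q) ∈ colouringRep star K b ↔ (x, y) ∈ θ b := by
    intro x p q a hp hpq
    obtain ⟨y, hy⟩ := (hp.defined_iff a).1 hpq.1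
    exact ⟨y, hy, htrans hp hy hpq⟩
  have hdom : ∀ {x p}, ColoursFuture θ x (K p) → ∀ a,
      (∃ q, (p, q) ∈ colouringRep star K a) ↔ ∃ y, (x, y) ∈ θ a := by
    intro x p hp a
    constructor
    · rintro ⟨q, hq⟩
      exact (hp.defined_iff a).1 hq.1
    · rintro ⟨y, hy⟩
      obtain ⟨q, -, hq⟩ := hforth hp hy
      exact ⟨q, (hq a).2 hy⟩
  have hfun' : ∀ a, Functional (colouringRep star K a) := fun a p q q' h h' =>
    hK (funext fun b => (h.2 b).trans (h'.2 b).symm)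
  have he' : colouringRep star K e = pId Y := by
    ext ⟨p, q⟩
    obtain ⟨x, hx⟩ := hpoint p
    constructor
    · rintro ⟨-, h⟩
      exact hK (funext fun b => by simpa [hleft] using (h b).symm)
    · intro hpq
      obtain rfl : p = q := hpq
      exact ⟨(hx.defined_iff e).2 ⟨x, by rw [he]; rfl⟩, fun b => by rw [hleft]⟩
  have hdiag : ∀ {x p}, ColoursFuture θ x (K p) → ∀ b,
      (p, p) ∈ colouringRep star K b ↔ (x, x) ∈ θ b := by
    intro x p hp
    exact (htrans (a := e) hp (by rw [he]; rfl) (by rw [he']; rfl)).2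
  have hsubid : ∀ b, θ b ⊆ pId X → colouringRep star K b ⊆ pId Y := by
    rintro b hb ⟨p, q⟩ hpq
    obtain ⟨x, hx⟩ := hpoint p
    obtain ⟨y, hy, -, hall⟩ := hback hx hpq
    rw [← he', hall, he]
    exact hb hy
  have hdiag_of : ∀ (b : A) (P : Set (Y × Y)), θ b ⊆ pId X → P ⊆ pId Y →
      (∀ x p, ColoursFuture θ x (K p) → ((p, p) ∈ P ↔ (x, x) ∈ θ b)) →
      colouringRep star K b = P := by
    intro b P hb hP h
    ext ⟨p, q⟩
    obtain ⟨x, hx⟩ := hpoint p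
    constructor
    · intro hpq
      obtain rfl : p = q := hsubid b hb hpq
      rwa [h x p hx, ← hdiag hx]
    · intro hpq
      obtain rfl : p = q := hP hpq
      rwa [hdiag hx, ← h x p hx]
  have hstar' : ∀ a b, colouringRep star K (star a b) =
      pComp (colouringRep star K a) (colouringRep star K b) := by
    intro a b
    ext ⟨p, q⟩
    obtain ⟨x, hx⟩ := hpoint p
    constructor
    · intro hpq
      obtain ⟨y, hy, hyq, hall⟩ := hback hx hpq
      have hy' := hy
      rw [hstar] at hy'
      obtain ⟨u, h₁, h₂⟩ := hy'
      obtain ⟨s, hs, hps⟩ := hforth hx h₁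
      have hpsa := (hps a).2 h₁
      refine ⟨s, hpsa, (hs.defined_iff b).2 ⟨y, h₂⟩, fun c => ?_⟩
      rw [hpsa.2, hpq.2, hassoc]
    · rintro ⟨s, h₁, h₂⟩
      obtain ⟨u, hu, hus, -⟩ := hback hx h₁
      obtain ⟨y, hy, -, -⟩ := hback hus h₂
      refine ⟨(hx.defined_iff _).2 ⟨y, by rw [hstar]; exact ⟨u, hu, hy⟩⟩, fun c => ?_⟩
      rw [h₂.2, h₁.2, hassoc]
  have had' : ∀ a, colouringRep star K (ad a) = pAnti (colouringRep star K a) := by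
    intro a
    refine hdiag_of _ _ (by rw [had]; exact fun _ h => h.1) (fun _ h => h.1) fun x p hp => ?_
    rw [had]
    simp only [pAnti, Set.mem_ofPred_eq, true_and, hdom hp]
  refine ⟨?_, hfun', hstar', ?_, ?_, ?_, ?_, had', ?_, ?_, ?_, ?_, he'⟩
  · intro a b hab
    have key : ∀ a b, colouringRep star K a = colouringRep star K b → θ a ⊆ θ b := by
      rintro a b hab ⟨x, y⟩ hxy
      obtain ⟨p, hp⟩ := hcol x
      obtain ⟨q, -, hq⟩ := hforth hp hxy
      rw [← hq, ← hab, hq]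
      exact hxy
    exact hinj ((key a b hab).antisymm (key b a hab.symm))
  · intro a b
    ext ⟨p, q⟩
    obtain ⟨x, hx⟩ := hpoint p
    constructor
    · intro hpq
      obtain ⟨y, hy, -, hall⟩ := hback hx hpq
      rw [hmeet] at hy
      exact ⟨(hall a).2 hy.1, (hall b).2 hy.2⟩
    · rintro ⟨h₁, h₂⟩
      obtain ⟨y, hy, -, hall⟩ := hback hx h₁
      rw [hall, hmeet]
      exact ⟨hy, (hall b).1 h₂⟩
  · intro a b
    ext ⟨p, q⟩
    obtain ⟨x, hx⟩ := hpoint p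
    have key : ∀ y, (∀ b, (p, q) ∈ colouringRep star K b ↔ (x, y) ∈ θ b) →
        ((p, q) ∈ colouringRep star K (pref a b) ↔
          (p, q) ∈ pPref (colouringRep star K a) (colouringRep star K b)) := by
      intro y hall
      rw [hall, hpref]
      simp only [pPref, Set.mem_union, Set.mem_ofPred_eq, hall, hdom hx]
    constructor
    · intro hpq
      obtain ⟨y, -, -, hall⟩ := hback hx hpq
      exact (key y hall).1 hpq
    · intro hpq
      obtain ⟨y, hall⟩ : ∃ y, ∀ b, (p, q) ∈ colouringRep star K b ↔ (x, y) ∈ θ b := by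
        rcases hpq with h | h
        · obtain ⟨y, -, -, hall⟩ := hback hx h
          exact ⟨y, hall⟩
        · obtain ⟨y, -, -, hall⟩ := hback hx h.1
          exact ⟨y, hall⟩
      exact (key y hall).2 hpq
  · intro a
    refine hdiag_of _ _ (by rw [hd]; exact fun _ h => h.1) (fun _ h => h.1) fun x p hp => ?_
    rw [hd]
    simp only [pDom, Set.mem_ofPred_eq, true_and, hdom hp]
  · intro a
    refine hdiag_of _ _ (by rw [hr]; exact fun _ h => h.1) (fun _ h => h.1) fun y q hq => ?_
    constructor
    · rintro ⟨-, p, hpq⟩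
      obtain ⟨x, hx⟩ := hpoint p
      obtain ⟨y', hy', hq', -⟩ := hback hx hpq
      rw [← hdiag hq, hdiag hq', hr]
      exact ⟨rfl, x, hy'⟩
    · rw [hr]
      rintro ⟨-, x, hxy⟩
      obtain ⟨⟨k, hk, hkq⟩, -⟩ := hq.exists_extension hfun hstar he hι hxy
      obtain ⟨p, rfl⟩ := (hrange k).2 ⟨x, hk⟩
      exact ⟨rfl, p, (hk.defined_iff a).2 ⟨y, hxy⟩, hkq⟩
  · intro a
    refine hdiag_of _ _ (by rw [hfix]; exact fun _ h => h.1) (fun _ h => h.1) fun x p hp => ?_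
    rw [hfix]
    simp only [pFix, Set.mem_ofPred_eq, true_and, hdiag hp]
  · intro a
    obtain ⟨t, ht⟩ : ∃ t : ℕ → A, ∀ n, θ (t n) = pPow (θ a) n ∧
        colouringRep star K (t n) = pPow (colouringRep star K a) n := by
      refine ⟨fun n => Nat.rec e (fun _ s => star a s) n, fun n => ?_⟩
      induction n with
      | zero => exact ⟨he, he'⟩
      | succ n ih =>
        constructor
        · change θ (star a _) = _
          rw [hstar, ih.1]
          rfl
        · change colouringRep star K (star a _) = _
          rw [hstar', ih.2]
          rfl
    have h₁ : θ (mi a) = ⋃ n, θ (star (t n) (ad a)) := by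
      rw [hmi, pMaxIter]
      simp only [hstar, had, ht]
    have h₂ : pMaxIter (colouringRep star K a) =
        ⋃ n, colouringRep star K (star (t n) (ad a)) := by
      rw [pMaxIter]
      simp only [hstar', had', ht]
    rw [h₂]
    ext ⟨p, q⟩
    obtain ⟨x, hx⟩ := hpoint p
    rw [Set.mem_iUnion]
    constructor
    · intro hpq
      obtain ⟨y, hy, -, hall⟩ := hback hx hpq
      rw [h₁, Set.mem_iUnion] at hy
      exact hy.imp fun n hn => (hall _).2 hn
    · rintro ⟨n, hpq⟩
      obtain ⟨y, hy, -, hall⟩ := hback hx hpq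
      rw [hall, h₁, Set.mem_iUnion]
      exact ⟨n, hy⟩
  · intro a
    ext ⟨q, p⟩
    have hinv : ∀ {x y p q}, ColoursFuture θ x (K p) → (y, x) ∈ θ (op a) →
        (p, q) ∈ colouringRep star K a → (q, p) ∈ colouringRep star K (op a) := by
      intro x y p q hp hyx hpq
      obtain ⟨y', hxy', hq, -⟩ := hback hp hpq
      have hyx' := hyx
      rw [hop] at hyx
      obtain rfl := hfun a x y y' hyx.1 hxy'
      refine ⟨(hq.defined_iff _).2 ⟨x, hyx'⟩, fun c => ?_⟩
      rw [hpq.2, ← hassoc]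
      have hxx : (p, p) ∈ colouringRep star K (star a (op a)) := by
        rw [hdiag hp, hstar]
        exact ⟨y, hxy', hyx'⟩
      exact hxx.2 c
    constructor
    · intro hqp
      obtain ⟨y, hy⟩ := hpoint q
      obtain ⟨x, hyx, hp, -⟩ := hback hy hqp
      have hyx' := hyx
      rw [hop] at hyx'
      have hyy : (q, q) ∈ colouringRep star K (star (op a) a) := by
        rw [hdiag hy, hstar]
        exact ⟨x, hyx, hyx'.1⟩
      refine ⟨⟨(hp.defined_iff a).2 ⟨y, hyx'.1⟩, fun c => ?_⟩, fun p' hp' => ?_⟩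
      · have := hyy.2 c
        dsimp only at this ⊢
        rw [this, hqp.2, hassoc]
      · obtain ⟨x', hx'⟩ := hpoint p'
        obtain ⟨y', hxy', hq', -⟩ := hback hx' hp'
        obtain ⟨u, hu⟩ := (hq'.defined_iff (op a)).1 hqp.1
        have hu' := hu
        rw [hop] at hu'
        obtain rfl := hu'.2 x' hxy'
        exact hfun' _ q p' p (hinv hx' hu hp') hqp
    · rintro ⟨hpq, huniq⟩
      obtain ⟨x, hx⟩ := hpoint p
      obtain ⟨y, hxy, hy, -⟩ := hback hx hpq
      have hext : ∀ k x', (x', y) ∈ θ a → ColoursFuture θ x' k → (∀ b, K q b = k (star a b)) →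
          k = K p := by
        intro k x' hx'y hk hkq
        obtain ⟨p', rfl⟩ := (hrange k).2 ⟨x', hk⟩
        rw [huniq p' ⟨(hk.defined_iff a).2 ⟨y, hx'y⟩, hkq⟩]
      have hxfut : x ∈ future θ y := by
        by_contra hcon
        obtain ⟨k₁, k₂, hne, h₁, h₂⟩ :=
          (hy.exists_extension hfun hstar he hι hxy).2 hcon
        exact hne ((hext k₁ x hxy h₁.1 h₁.2).trans (hext k₂ x hxy h₂.1 h₂.2).symm)
      obtain ⟨b, hb⟩ := hxfut
      refine hinv hx (y := y) ?_ hpq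
      rw [hop]
      refine ⟨hxy, fun x' hx' => ?_⟩
      obtain ⟨⟨k, hk, hkq⟩, -⟩ := hy.exists_extension hfun hstar he hι hx'
      obtain rfl := hext k x' hx' hk hkq
      have h₁ : (x, x) ∈ θ (star a b) := by
        rw [hstar]
        exact ⟨y, hxy, hb⟩
      rw [← hdiag hx, hdiag hk, hstar] at h₁
      obtain ⟨y', h₂, h₃⟩ := h₁
      obtain rfl := hfun a x' y y' hx' h₂
      exact hfun b y x' x h₃ hb
  · ext ⟨p, q⟩
    obtain ⟨x, hx⟩ := hpoint p
    simp only [Set.mem_empty_iff_false, iff_false]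
    intro hpq
    obtain ⟨y, hy, -, -⟩ := hback hx hpq
    rw [hz] at hy
    exact hy

/-- A double-exponential bound on the size of base required for a representation. -/
theorem frp_double_exponential_bound :
    ∃ c : ℕ, ∀ (A : Type u) [Fintype A] (star meet pref : A → A → A)
      (d r ad fix mi op : A → A) (z e : A),
      (∃ (X : Type v) (θ : A → Set (X × X)),
        IsRepFull star meet pref d r ad fix mi op z e θ) →
      ∃ (Y : Type w) (iY : Fintype Y) (θ : A → Set (Y × Y)),
        IsRepFull star meet pref d r ad fix mi op z e θ ∧
        @Fintype.card Y iY ≤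
          Fintype.card A ^ (Fintype.card A ^ (c * (Nat.sqrt (Fintype.card A) + 1))) := by
  classical
  refine ⟨2, fun A _ star meet pref d r ad fix mi op z e ⟨X, θ, hθ⟩ => ?_⟩
  let n := Fintype.card A
  let Y₀ := {k : A → Option (Fin (n + 1)) // ∃ x, ColoursFuture θ x k}
  let f : ULift.{w} (Fin (Fintype.card Y₀)) ≃ Y₀ := Equiv.ulift.trans (Fintype.equivFin Y₀).symm
  refine ⟨ULift.{w} (Fin (Fintype.card Y₀)), inferInstance,
    colouringRep star (fun p => (f p).1), isRepFull_colouringRep hθ (by simp [n])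
      (Subtype.val_injective.comp f.injective) (fun k => ?_), ?_⟩
  · constructor
    · rintro ⟨p, rfl⟩
      exact (f p).2
    · intro hk
      exact ⟨f.symm ⟨k, hk⟩, by simp⟩
  · rw [Fintype.card_ulift, Fintype.card_fin]
    have hcard : Fintype.card Y₀ ≤ (n + 2) ^ n := by
      refine (Fintype.card_subtype_le _).trans ?_
      simp [n]
    change _ ≤ n ^ (n ^ (2 * (Nat.sqrt n + 1)))
    have hpos : 0 < n := Fintype.card_pos_iff.2 ⟨z⟩
    rcases Nat.lt_or_ge 1 n with hn | hn
    · calc Fintype.card Y₀ ≤ (n + 2) ^ n := hcard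
        _ ≤ (n ^ 2) ^ n := Nat.pow_le_pow_left (by nlinarith) n
        _ = n ^ (2 * n) := by rw [← pow_mul]
        _ ≤ n ^ (n ^ (2 * (Nat.sqrt n + 1))) := by
          refine Nat.pow_le_pow_right hpos ?_
          calc 2 * n ≤ n ^ 2 := by nlinarith
            _ ≤ n ^ (2 * (Nat.sqrt n + 1)) := Nat.pow_le_pow_right hpos (by omega)
    · obtain ⟨-, -, -, -, -, -, -, -, -, -, -, hz, he⟩ := hθ
      have hempty : IsEmpty Y₀ := ⟨fun ⟨_, x, _⟩ => by
        have hx : (x, x) ∈ θ e := by rw [he]; rfl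
        rw [Fintype.card_le_one_iff.1 hn e z, hz] at hx
        exact hx⟩
      rw [Fintype.card_eq_zero]
      exact Nat.zero_le _
end

section
/- (Uniqueness of futures.) Let A be a finite type with binary operations ⋆, ⊓ and unary operations d, r, let θ be a representation of A by partial functions on X and θ' a representation on X'. Let x ∈ X and x' ∈ X' be such that (x,x) ∈ θ(b) for some b ∈ A, (x',x') ∈ θ'(b') for some b' ∈ A, and for every b ∈ A, (x,x) ∈ θ(b) ↔ (x',x') ∈ θ'(b). Then there is a bijection φ from the future of x (with respect to θ) to the future of x' (with respect to θ') such that for all y, z in the future of x and all a ∈ A, (y,z) ∈ θ(a) ↔ (φ(y), φ(z)) ∈ θ'(a). -/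
universe u v w

/-- An element is defined at one of two vertices with matching loops iff it is defined at
the other. -/
theorem IsRepDR.exists_edge_iff {A : Type*} {X : Type u} {X' : Type v}
    {star meet : A → A → A} {d r : A → A} {θ : A → Set (X × X)} {θ' : A → Set (X' × X')}
    (hθ : IsRepDR star meet d r θ) (hθ' : IsRepDR star meet d r θ') {x : X} {x' : X'}
    (hmatch : ∀ b : A, (x, x) ∈ θ b ↔ (x', x') ∈ θ' b) (b : A) :
    (∃ y, (x, y) ∈ θ b) ↔ ∃ y', (x', y') ∈ θ' b := by
  obtain ⟨-, -, -, -, hd, -⟩ := hθ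
  obtain ⟨-, -, -, -, hd', -⟩ := hθ'
  simpa [hd, hd', pDom] using hmatch (d b)

/-- Every vertex in the future of `x` has a counterpart that is reached from `x'` by the same
elements. -/
theorem IsRepDR.exists_counterpart {A : Type*} {X : Type u} {X' : Type v}
    {star meet : A → A → A} {d r : A → A} {θ : A → Set (X × X)} {θ' : A → Set (X' × X')}
    (hθ : IsRepDR star meet d r θ) (hθ' : IsRepDR star meet d r θ') {x : X} {x' : X'}
    (hmatch : ∀ b : A, (x, x) ∈ θ b ↔ (x', x') ∈ θ' b) (y : future θ x) :
    ∃ y' : future θ' x', ∀ b : A, (x, (y : X)) ∈ θ b ↔ (x', (y' : X')) ∈ θ' b := by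
  have hdom := hθ.exists_edge_iff hθ' hmatch
  obtain ⟨-, hfun, -, hmeet, -, -⟩ := hθ
  obtain ⟨-, hfun', -, hmeet', -, -⟩ := hθ'
  obtain ⟨y, c, hc⟩ := y
  obtain ⟨y', hc'⟩ := (hdom c).1 ⟨y, hc⟩
  refine ⟨⟨y', c, hc'⟩, fun b => ⟨fun hb => ?_, fun hb => ?_⟩⟩
  · obtain ⟨z, hz⟩ := (hdom (meet c b)).1 ⟨y, by rw [hmeet]; exact ⟨hc, hb⟩⟩
    rw [hmeet'] at hz
    exact hfun' c _ _ _ hz.1 hc' ▸ hz.2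
  · obtain ⟨z, hz⟩ := (hdom (meet c b)).2 ⟨y', by rw [hmeet']; exact ⟨hc', hb⟩⟩
    rw [hmeet] at hz
    exact hfun c _ _ _ hz.1 hc ▸ hz.2

/-- An edge between two vertices in the future of `x` is determined by the domain, at `x`, of an
element of the algebra. -/
theorem IsRepDR.edge_iff {A : Type*} {X : Type u}
    {star meet : A → A → A} {d r : A → A} {θ : A → Set (X × X)}
    (hθ : IsRepDR star meet d r θ) {x y z : X} {b c : A} (hb : (x, y) ∈ θ b)
    (hc : (x, z) ∈ θ c) (a : A) :
    (y, z) ∈ θ a ↔ ∃ w, (x, w) ∈ θ (meet (star b a) c) := by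
  obtain ⟨-, hfun, hstar, hmeet, -, -⟩ := hθ
  simp only [hmeet, hstar]
  constructor
  · exact fun h => ⟨z, ⟨y, hb, h⟩, hc⟩
  · rintro ⟨w, ⟨v, hv, hvw⟩, hw⟩
    obtain rfl := hfun b _ _ _ hv hb
    obtain rfl := hfun c _ _ _ hw hc
    exact hvw

/-- Uniqueness of futures: two vertices with matching reflexive-edge information, in two
representations, have isomorphic futures. -/
theorem unique_futures {A : Type*} [Fintype A] {X : Type u} {X' : Type v}
    (star meet : A → A → A) (d r : A → A)
    (θ : A → Set (X × X)) (θ' : A → Set (X' × X'))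
    (hθ : IsRepDR star meet d r θ) (hθ' : IsRepDR star meet d r θ')
    (x : X) (x' : X')
    (hx : ∃ b : A, (x, x) ∈ θ b) (hx' : ∃ b : A, (x', x') ∈ θ' b)
    (hmatch : ∀ b : A, (x, x) ∈ θ b ↔ (x', x') ∈ θ' b) :
    ∃ φ : future θ x → future θ' x', Function.Bijective φ ∧
      ∀ (y z : future θ x) (a : A),
        ((y : X), (z : X)) ∈ θ a ↔ ((φ y : X'), (φ z : X')) ∈ θ' a := by
  choose φ hφ using hθ.exists_counterpart hθ' hmatch
  refine ⟨φ, ⟨fun y z hyz => ?_, fun y' => ?_⟩, fun y z a => ?_⟩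
  · obtain ⟨b, hb⟩ := y.2
    have hz := (hφ z b).2 (hyz ▸ (hφ y b).1 hb)
    exact Subtype.ext (hθ.2.1 b _ _ _ hb hz)
  · obtain ⟨y, hy⟩ := hθ'.exists_counterpart hθ (fun b => (hmatch b).symm) y'
    obtain ⟨b, hb⟩ := y'.2
    exact ⟨y, Subtype.ext (hθ'.2.1 b _ _ _ ((hφ y b).1 ((hy b).1 hb)) hb)⟩
  · obtain ⟨b, hb⟩ := y.2
    obtain ⟨c, hc⟩ := z.2
    rw [hθ.edge_iff hb hc, hθ'.edge_iff ((hφ y b).1 hb) ((hφ z c).1 hc)]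
    exact hθ.exists_edge_iff hθ' hmatch _
end

section
/- Let A be a finite type with binary operations ⋆, ⊓ and unary operations d, r, let θ be a representation of A by partial functions on X, and let x ∈ X and α ∈ A be such that α labels the edge (x,x), i.e. (x,x) ∈ θ(α) and for all b ∈ A, (x,x) ∈ θ(b) implies α ⊓ b = α. Then for every a ∈ A: there exists y ∈ X such that a labels the edge (x,y) (i.e. (x,y) ∈ θ(a) and for all b ∈ A, (x,y) ∈ θ(b) implies a ⊓ b = a) if and only if d(a) = α. -/
universe u v w

/-- At an `α`-vertex `x`, there is an edge starting at `x` labelled `a` iff `d a = α`. -/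
theorem edges_from_alpha_vertex {A : Type*} [Fintype A] {X : Type u}
    (star meet : A → A → A) (d r : A → A) (θ : A → Set (X × X))
    (hθ : IsRepDR star meet d r θ)
    (x : X) (α : A) (hα : Labels meet θ α x x) :
    ∀ a : A, (∃ y : X, Labels meet θ a x y) ↔ d a = α := by
  obtain ⟨hinj, hfun, hstar, hmeet, hd, -⟩ := hθ
  obtain ⟨hx, hmin⟩ := hα
  have le_of_meet : ∀ {b c : A}, meet b c = b → θ b ⊆ θ c := fun {b c} h => by
    rw [← h, hmeet]
    exact Set.inter_subset_right
  have mem_d : ∀ {b : A} {u v : X}, (u, v) ∈ θ b → (u, u) ∈ θ (d b) := fun {b u v} h => by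
    rw [hd]
    exact ⟨rfl, v, h⟩
  have α_le : ∀ {b : A}, (x, x) ∈ θ b → θ α ⊆ θ b := fun h => le_of_meet (hmin _ h)
  have α_diag : ∀ {u v : X}, (u, v) ∈ θ α → u = v := fun {u v} h => by
    have h' := α_le (mem_d hx) h
    rw [hd] at h'
    exact h'.1
  intro a
  constructor
  · rintro ⟨y, hxy, hleast⟩
    apply hinj
    refine Set.Subset.antisymm ?_ (α_le (mem_d hxy))
    rintro ⟨u, u'⟩ hu
    rw [hd] at hu
    obtain ⟨rfl : u = u', v, huv⟩ := hu
    have hcomp : (x, y) ∈ θ (star α a) := by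
      rw [hstar]
      exact ⟨x, hx, hxy⟩
    have huv' := le_of_meet (hleast _ hcomp) huv
    rw [hstar] at huv'
    obtain ⟨w, huw, -⟩ := huv'
    obtain rfl : u = w := α_diag huw
    exact huw
  · rintro rfl
    have hx' := hx
    rw [hd] at hx'
    obtain ⟨-, y, hxy⟩ := hx'
    refine ⟨y, hxy, fun b hb => hinj ?_⟩
    have hab : (x, y) ∈ θ (meet a b) := by
      rw [hmeet]
      exact ⟨hxy, hb⟩
    refine Set.Subset.antisymm (by rw [hmeet]; exact Set.inter_subset_left) ?_
    rintro ⟨u, v⟩ huv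
    have hu := α_le (mem_d hab) (mem_d huv)
    rw [hd] at hu
    obtain ⟨-, w, huw⟩ := hu
    have huw' := huw
    rw [hmeet] at huw'
    obtain rfl : v = w := hfun a u v w huv huw'.1
    exact huw
end

section
/- Let A be a finite type with binary operations ⋆, ⊓ and unary operations d, r, let θ be a representation of A by partial functions on X, and let x, y, z ∈ X and α, a, b ∈ A be such that α labels the edge (x,x), a labels the edge (x,y), and b labels the edge (x,z). Then for every c ∈ A, (y,z) ∈ θ(c) if and only if a ⋆ c = b. -/
universe u v w

/-- The label of an edge is contained in every element holding on that edge. -/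
theorem Labels.subset {A : Type*} {X : Type u} {meet : A → A → A} {θ : A → Set (X × X)}
    (hmeet : ∀ a b, θ (meet a b) = θ a ∩ θ b) {a b : A} {x y : X}
    (ha : Labels meet θ a x y) (hb : (x, y) ∈ θ b) : θ a ⊆ θ b := by
  rw [← Set.inter_eq_left, ← hmeet, ha.2 b hb]

/-- If `α` labels `(x,x)`, `a` labels `(x,y)` and `b` labels `(x,z)`, then `c` holds on
`(y,z)` iff `a ⋆ c = b`. -/
theorem label_composition {A : Type*} [Fintype A] {X : Type u}
    (star meet : A → A → A) (d r : A → A) (θ : A → Set (X × X))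
    (hθ : IsRepDR star meet d r θ)
    (x y z : X) (α a b : A)
    (hα : Labels meet θ α x x) (ha : Labels meet θ a x y) (hb : Labels meet θ b x z) :
    ∀ c : A, (y, z) ∈ θ c ↔ star a c = b := by
  obtain ⟨hinj, hfun, hstar, hmeet, hdom, -⟩ := hθ
  intro c
  constructor
  · intro hc
    have hac : (x, z) ∈ θ (star a c) := by
      rw [hstar]
      exact ⟨y, ha.1, hc⟩
    have hba : θ b ⊆ θ (star a c) := hb.subset hmeet hac
    have had : θ a ⊆ θ (star (d b) a) := by
      refine ha.subset hmeet ?_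
      rw [hstar, hdom]
      exact ⟨x, ⟨rfl, z, hb.1⟩, ha.1⟩
    refine hinj (Set.Subset.antisymm ?_ hba)
    rintro ⟨u, v⟩ huv
    obtain ⟨w, huw, -⟩ : (u, v) ∈ pComp (θ a) (θ c) := hstar a c ▸ huv
    have huw' := had huw
    rw [hstar, hdom] at huw'
    obtain ⟨_, ⟨-, t, hut⟩, -⟩ := huw'
    exact hfun _ u t v (hba hut) huv ▸ hut
  · rintro rfl
    obtain ⟨w, hxw, hwz⟩ : (x, z) ∈ pComp (θ a) (θ c) := hstar a c ▸ hb.1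
    exact hfun a x w y hxw ha.1 ▸ hwz
end

section
/- Let A be a finite type with binary operations ⋆, ⊓ and unary operations ad, r, and let θ be a representation of (A, ⋆, ⊓, ad, r) by partial functions on X (antidomain signature). Write 0 for the element ad(c) ⋆ c (for any c ∈ A), and call e ∈ A an atom if e ≠ 0 and every b ∈ A with b ⊓ e = b and b ≠ 0 equals e. Then: (i) for every pair (x,y) ∈ X × X such that (x,y) ∈ θ(b) for some b ∈ A, there is exactly one atom a of A with (x,y) ∈ θ(a); and (ii) for every atom a of A, θ(a) ≠ ∅. -/
universe u v w

/-- Representation for the signature {composition, intersection, antidomain, range}. -/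
def IsRepAd {A : Type*} {X : Type u} (star meet : A → A → A) (ad r : A → A)
    (θ : A → Set (X × X)) : Prop :=
  Function.Injective θ ∧ (∀ a, Functional (θ a)) ∧
  (∀ a b, θ (star a b) = pComp (θ a) (θ b)) ∧
  (∀ a b, θ (meet a b) = θ a ∩ θ b) ∧
  (∀ a, θ (ad a) = pAnti (θ a)) ∧
  (∀ a, θ (r a) = pRan (θ a))

namespace IsRepAd

variable {A : Type*} {X : Type u} {star meet : A → A → A} {ad r : A → A} {θ : A → Set (X × X)}

theorem eq_zero_iff (hθ : IsRepAd star meet ad r θ) (a₀ a : A) :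
    a = star (ad a₀) a₀ ↔ θ a = ∅ := by
  obtain ⟨hinj, -, hstar, -, had, -⟩ := hθ
  have h0 : θ (star (ad a₀) a₀) = ∅ := by
    rw [hstar, had, Set.eq_empty_iff_forall_notMem]
    rintro ⟨x, y⟩ ⟨z, ⟨hxz, hz⟩, hzy⟩
    dsimp only at hxz hz hzy
    exact hz ⟨y, hxz ▸ hzy⟩
  rw [← h0, hinj.eq_iff]

theorem meet_eq_left_iff (hθ : IsRepAd star meet ad r θ) (a b : A) :
    meet a b = a ↔ θ a ⊆ θ b := by
  obtain ⟨hinj, -, -, hmeet, -, -⟩ := hθ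
  rw [← hinj.eq_iff, hmeet, Set.inter_eq_left]

theorem exists_labels [Finite A] (hθ : IsRepAd star meet ad r θ) {x y : X}
    (h : ∃ b, (x, y) ∈ θ b) : ∃ a, Labels meet θ a x y := by
  obtain ⟨a, ha⟩ := (Set.toFinite {b | (x, y) ∈ θ b}).exists_minimalFor θ _ h
  refine ⟨a, ha.1, fun b hb => (hθ.meet_eq_left_iff a b).2 ?_⟩
  have hmeet : θ (meet a b) = θ a ∩ θ b := hθ.2.2.2.1 a b
  have hle : θ a ⊆ θ (meet a b) :=
    ha.2 (show (x, y) ∈ θ (meet a b) from hmeet ▸ ⟨ha.1, hb⟩)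
      (hmeet ▸ Set.inter_subset_left)
  exact fun p hp => (hmeet ▸ hle hp : p ∈ θ a ∩ θ b).2

/-- A nonempty restriction of the label of an edge is the label itself: otherwise, removing
its domain from the label would give a smaller element holding on the edge. -/
theorem eq_of_labels (hθ : IsRepAd star meet ad r θ) {a c : A} {x y : X}
    (ha : Labels meet θ a x y) (hca : θ c ⊆ θ a) (hc : (θ c).Nonempty) : c = a := by
  have hmin : ∀ b, (x, y) ∈ θ b → θ a ⊆ θ b := fun b hb =>
    (hθ.meet_eq_left_iff a b).1 (ha.2 b hb)
  obtain ⟨hinj, hfun, hstar, -, had, -⟩ := hθ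
  by_cases hxy : (x, y) ∈ θ c
  · exact hinj (hca.antisymm (hmin c hxy))
  have hx : (x, y) ∈ θ (star (ad c) a) := by
    rw [hstar, had]
    refine ⟨x, ⟨rfl, ?_⟩, ha.1⟩
    rintro ⟨z, hz⟩
    exact hxy (hfun a x z y (hca hz) ha.1 ▸ hz)
  obtain ⟨⟨u, v⟩, huv⟩ := hc
  have hu := hmin _ hx (hca huv)
  rw [hstar, had] at hu
  obtain ⟨w, ⟨_, hu⟩, _⟩ := hu
  exact (hu ⟨v, huv⟩).elim

end IsRepAd

/-- In a representation of a finite algebra of the antidomain signature, every edge has a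
unique atom holding on it, and every atom holds on some edge. -/
theorem atoms_label_edges {A : Type*} [Fintype A] {X : Type u}
    (star meet : A → A → A) (ad r : A → A) (θ : A → Set (X × X))
    (hθ : IsRepAd star meet ad r θ) :
    ∀ a₀ : A,
      (∀ x y : X, (∃ b : A, (x, y) ∈ θ b) →
        ∃! a : A,
          (a ≠ star (ad a₀) a₀ ∧
            ∀ b : A, meet b a = b → b ≠ star (ad a₀) a₀ → b = a) ∧
          (x, y) ∈ θ a) ∧
      (∀ a : A,
        (a ≠ star (ad a₀) a₀ ∧
          ∀ b : A, meet b a = b → b ≠ star (ad a₀) a₀ → b = a) →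
        θ a ≠ (∅ : Set (X × X))) := by
  intro a₀
  simp only [ne_eq, hθ.eq_zero_iff a₀, hθ.meet_eq_left_iff]
  refine ⟨fun x y h => ?_, fun a ha => ha.1⟩
  obtain ⟨a, ha⟩ := hθ.exists_labels h
  refine ⟨a, ⟨⟨Set.nonempty_iff_ne_empty.1 ⟨_, ha.1⟩, fun b hba hb =>
    hθ.eq_of_labels ha hba (Set.nonempty_iff_ne_empty.2 hb)⟩, ha.1⟩, ?_⟩
  rintro b ⟨⟨-, hb⟩, hxy⟩
  exact (hb a ((hθ.meet_eq_left_iff a b).1 (ha.2 b hxy))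
    (Set.nonempty_iff_ne_empty.1 ⟨_, ha.1⟩)).symm
end

section
/- Let A be a type with binary operations ⋆, ⊓ and unary operations ad, r, and let θ be a representation of (A, ⋆, ⊓, ad, r) by partial functions on X (antidomain signature). Then for all a, b ∈ A with b ⊓ a = b (i.e. b ≤ a), the element ad(b) ⋆ a is the complement of b relative to a: θ(b) ∩ θ(ad(b) ⋆ a) = ∅ and θ(b) ∪ θ(ad(b) ⋆ a) = θ(a). -/
universe u v w

/-- Relative complements in down-sets: for `b ≤ a`, the element `ad b ⋆ a` is the complement
of `b` relative to `a`. -/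
theorem relative_complement {A : Type*} {X : Type u}
    (star meet : A → A → A) (ad r : A → A) (θ : A → Set (X × X))
    (hθ : IsRepAd star meet ad r θ) :
    ∀ a b : A, meet b a = b →
      θ b ∩ θ (star (ad b) a) = (∅ : Set (X × X)) ∧
      θ b ∪ θ (star (ad b) a) = θ a := by
  obtain ⟨-, hfun, hstar, hmeet, had, -⟩ := hθ
  intro a b hba
  have hsub : θ b ⊆ θ a := by
    rw [← Set.inter_eq_left, ← hmeet, hba]
  have hmem : ∀ x y : X,
      (x, y) ∈ θ (star (ad b) a) ↔ (¬∃ z, (x, z) ∈ θ b) ∧ (x, y) ∈ θ a := by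
    intro x y
    rw [hstar, had]
    constructor
    · rintro ⟨z, ⟨hxz, hx⟩, hz⟩
      obtain rfl : x = z := hxz
      exact ⟨hx, hz⟩
    · rintro ⟨hx, hxy⟩
      exact ⟨x, ⟨rfl, hx⟩, hxy⟩
  constructor
  · ext ⟨x, y⟩
    simp only [Set.mem_inter_iff, hmem, Set.mem_empty_iff_false, iff_false]
    exact fun h => h.2.1 ⟨y, h.1⟩
  · ext ⟨x, y⟩
    simp only [Set.mem_union, hmem]
    constructor
    · rintro (h | h)
      · exact hsub h
      · exact h.2
    · intro hxy
      by_cases hx : ∃ z, (x, z) ∈ θ b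
      · obtain ⟨z, hz⟩ := hx
        exact Or.inl (hfun a x y z hxy (hsub hz) ▸ hz)
      · exact Or.inr ⟨hx, hxy⟩
end
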